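/- arXiv:2507.10351 — 7 statements merged into one kernel-verified Lean document; each statement's English description precedes it below -/
import Mathlib

section
/- If T is a tree of maximum degree Δ at least 3 with ℓ leaves, then the number lp(T) of different lengths of leaf to leaf paths in T satisfies lp(T) ≥ log_{Δ−1}((Δ−2)·ℓ). -/
open SimpleGraph

/-- The degree of a vertex `v` in a graph `G`. -/
noncomputable def gdeg {V : Type*} (G : SimpleGraph V) (v : V) : ℕ := {u | G.Adj v u}.ncard

/-- A leaf of a tree: a vertex of degree at most `1`. -/
def IsLeafV {V : Type*} (G : SimpleGraph V) (v : V) : Prop := gdeg G v ≤ 1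

/-- The set of lengths of leaf-to-leaf paths in a tree (in a tree the unique path
between two vertices has length equal to their distance); the trivial one-vertex
paths of length `0` are included. -/
def lpSet {V : Type*} (G : SimpleGraph V) : Set ℕ :=
  {n | ∃ u v : V, IsLeafV G u ∧ IsLeafV G v ∧ G.dist u v = n}

/-- In the tree `G` rooted at `r`, `u` is a child of `v`. -/
def IsChild {V : Type*} (G : SimpleGraph V) (r v u : V) : Prop :=
  G.Adj v u ∧ G.dist r u = G.dist r v + 1

/-- The out-degree (number of children) of `v` in the tree `G` rooted at `r`. -/
noncomputable def outdeg {V : Type*} (G : SimpleGraph V) (r v : V) : ℕ :=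
  {u | IsChild G r v u}.ncard

/-- A leaf of the rooted tree `(G, r)`: a vertex without children. -/
def IsRLeaf {V : Type*} (G : SimpleGraph V) (r v : V) : Prop := ∀ u, ¬ IsChild G r v u

/-- The height of the rooted tree `(G, r)`: the maximum depth of a vertex. -/
noncomputable def rheight {V : Type*} (G : SimpleGraph V) (r : V) : ℕ :=
  sSup {d | ∃ v, G.dist r v = d}

/-- The out-degree sequence (as a multiset) of the rooted tree `(G, r)`. -/
noncomputable def outDegSeq {V : Type*} [Fintype V] (G : SimpleGraph V) (r : V) : Multiset ℕ :=
  Multiset.map (outdeg G r) Finset.univ.val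

/-- The degree sequence (as a multiset) of `G`. -/
noncomputable def degSeq {V : Type*} [Fintype V] (G : SimpleGraph V) : Multiset ℕ :=
  Multiset.map (gdeg G) Finset.univ.val

/-- The eccentricity of a vertex. -/
noncomputable def ecc {V : Type*} (G : SimpleGraph V) (v : V) : ℕ := sSup {d | ∃ u, G.dist v u = d}

/-- The radius of `G`. -/
noncomputable def treeRadius {V : Type*} (G : SimpleGraph V) : ℕ := sInf {e | ∃ v, ecc G v = e}

/-- The diameter of `G`. -/
noncomputable def treeDiam {V : Type*} (G : SimpleGraph V) : ℕ := sSup {d | ∃ u v : V, G.dist u v = d}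

/-- `radSeq s` is the minimum radius of a tree with degree sequence `s`. -/
noncomputable def radSeq (s : Multiset ℕ) : ℕ :=
  sInf {e | ∃ G : SimpleGraph (Fin (Multiset.card s)), G.IsTree ∧ degSeq G = s ∧ treeRadius G = e}

/-- `hSeq s` is the minimum height of a rooted tree with out-degree sequence `s`. -/
noncomputable def hSeq (s : Multiset ℕ) : ℕ :=
  sInf {h | ∃ (G : SimpleGraph (Fin (Multiset.card s))) (r : Fin (Multiset.card s)),
    G.IsTree ∧ outDegSeq G r = s ∧ rheight G r = h}

/-- The feasible heights for `hSeqK s k`: heights of rooted trees with at least `k` leaves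
whose out-degree sequence is a subsequence of `s`. -/
def hFeas (s : Multiset ℕ) (k : ℕ) : Set ℕ :=
  {h | ∃ (m : ℕ) (G : SimpleGraph (Fin m)) (r : Fin m),
    G.IsTree ∧ outDegSeq G r ≤ s ∧ k ≤ {v | IsRLeaf G r v}.ncard ∧ rheight G r = h}

/-- `hSeqK s k` is the minimum height of a rooted tree with at least `k` leaves whose
out-degree sequence is a subsequence of `s`. -/
noncomputable def hSeqK (s : Multiset ℕ) (k : ℕ) : ℕ := sInf (hFeas s k)

/-- In the tree `G` rooted at `r`, `a` is an ancestor of `b` (i.e. `a` lies on the path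
from `r` to `b`). -/
def Ancestor {V : Type*} (G : SimpleGraph V) (r a b : V) : Prop :=
  G.dist r a + G.dist a b = G.dist r b

open Classical in
/-- The out-degree sequence of the rooted subtree of `(G, r)` at `w` (its vertices are the
descendants of `w`, and their children in the subtree coincide with their children in `(G, r)`). -/
noncomputable def subSeq {V : Type*} [Fintype V] (G : SimpleGraph V) (r w : V) : Multiset ℕ :=
  Multiset.map (outdeg G r) (Multiset.filter (fun x => Ancestor G r w x) Finset.univ.val)

section LeafPaths

variable {V : Type*}

lemma tree_parent_unique (G : SimpleGraph V) (hT : G.IsTree) (x u u' v : V)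
    (h : G.Adj u v) (h' : G.Adj u' v) (hd : G.dist x v = G.dist x u + 1)
    (hd' : G.dist x v = G.dist x u' + 1) : u = u' := by
  obtain ⟨p, hp⟩ := hT.1.exists_walk_length_eq_dist x u
  obtain ⟨p', hp'⟩ := hT.1.exists_walk_length_eq_dist x u'
  have h1 : (p.concat h).IsPath :=
    SimpleGraph.Walk.isPath_of_length_eq_dist _ (by simp [hp, hd])
  have h2 : (p'.concat h').IsPath :=
    SimpleGraph.Walk.isPath_of_length_eq_dist _ (by simp [hp', hd'])
  have := hT.2.path_unique ⟨_, h1⟩ ⟨_, h2⟩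
  have h3 : p.concat h = p'.concat h' := congrArg Subtype.val this
  have h4 := congrArg SimpleGraph.Walk.penultimate h3
  simpa using h4

lemma exists_parent (G : SimpleGraph V) (hT : G.IsTree) (x : V) :
    ∃ f : V → V, (∀ v, v ≠ x → G.Adj v (f v) ∧ G.dist x v = G.dist x (f v) + 1) ∧
      ∀ u v, G.Adj u v → G.dist x v = G.dist x u + 1 → u = f v := by
  have : ∀ v, ∃ u, v ≠ x → G.Adj v u ∧ G.dist x v = G.dist x u + 1 := by
    intro v
    by_cases hv : v = x
    · exact ⟨v, fun h => absurd hv h⟩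
    obtain ⟨p, hp⟩ := hT.1.exists_walk_length_eq_dist v x
    cases p with
    | nil => exact absurd rfl hv
    | cons h q =>
      rename_i w
      refine ⟨w, fun _ => ⟨h, ?_⟩⟩
      have h1 := SimpleGraph.dist_le q
      have h2 := hT.1.dist_triangle (u := v) (v := w) (w := x)
      have h3 : G.dist v w = 1 := SimpleGraph.dist_eq_one_iff_adj.2 h
      rw [SimpleGraph.Walk.length_cons] at hp
      rw [G.dist_comm (u := x) (v := v), G.dist_comm (u := x) (v := w)]
      omega
  choose f hf using this
  refine ⟨f, hf, fun u v h hd => ?_⟩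
  have hv : v ≠ x := by
    rintro rfl
    simp at hd
  exact tree_parent_unique G hT x u (f v) v h (hf v hv).1.symm hd (hf v hv).2

/-- `f` is the parent function of `G` rooted at `x`. -/
structure IsPar (G : SimpleGraph V) (x : V) (f : V → V) : Prop where
  adj : ∀ v, v ≠ x → G.Adj v (f v)
  dep : ∀ v, v ≠ x → G.dist x v = G.dist x (f v) + 1
  uni : ∀ u v, G.Adj u v → G.dist x v = G.dist x u + 1 → u = f v

lemma adj_cases (G : SimpleGraph V) (hT : G.IsTree) (x u v : V) (h : G.Adj u v) :
    G.dist x v = G.dist x u + 1 ∨ G.dist x u = G.dist x v + 1 := by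
  have h0 := hT.dist_ne_of_adj x h
  have h1 := hT.1.dist_triangle (u := x) (v := u) (w := v)
  have h2 := hT.1.dist_triangle (u := x) (v := v) (w := u)
  have h3 : G.dist u v = 1 := SimpleGraph.dist_eq_one_iff_adj.2 h
  have h4 : G.dist v u = 1 := SimpleGraph.dist_eq_one_iff_adj.2 h.symm
  omega

lemma IsPar.dep_iter {G : SimpleGraph V} {x : V} {f : V → V} (hf : IsPar G x f)
    (k : ℕ) : ∀ v, k ≤ G.dist x v → G.dist x (f^[k] v) + k = G.dist x v := by
  induction k with
  | zero => intro v _; simp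
  | succ k ih =>
    intro v hk
    have hv : v ≠ x := by rintro rfl; simp at hk
    have := hf.dep v hv
    rw [Function.iterate_succ_apply]
    have := ih (f v) (by omega)
    omega

lemma IsPar.dist_iter {G : SimpleGraph V} (hT : G.IsTree) {x : V} {f : V → V} (hf : IsPar G x f)
    (k : ℕ) : ∀ v, k ≤ G.dist x v → G.dist v (f^[k] v) ≤ k := by
  induction k with
  | zero => intro v _; simp
  | succ k ih =>
    intro v hk
    have hv : v ≠ x := by rintro rfl; simp at hk
    have := hf.dep v hv
    rw [Function.iterate_succ_apply]
    have := ih (f v) (by omega)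
    have h2 := hT.1.dist_triangle (u := v) (v := f v) (w := f^[k] (f v))
    have h3 : G.dist v (f v) = 1 := SimpleGraph.dist_eq_one_iff_adj.2 (hf.adj v hv)
    omega

lemma IsPar.walk {G : SimpleGraph V} (hT : G.IsTree) {x : V} {f : V → V} (hf : IsPar G x f)
    {u v : V} (p : G.Walk u v) : ∃ i j, i + j ≤ p.length ∧ i ≤ G.dist x u ∧ j ≤ G.dist x v ∧
      f^[i] u = f^[j] v := by
  induction p with
  | nil => exact ⟨0, 0, by simp, by simp, by simp, rfl⟩
  | cons h q ih =>
    rename_i u w v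
    obtain ⟨i, j, hij, hi, hj, he⟩ := ih
    rw [SimpleGraph.Walk.length_cons]
    rcases adj_cases G hT x u w h with hd | hd
    · have hu := hf.uni u w h hd
      cases i with
      | zero =>
        refine ⟨0, j + 1, by omega, by omega, ?_, ?_⟩
        · have := hf.dep_iter j v hj
          rw [← he] at this
          simp at this
          omega
        · rw [Function.iterate_succ_apply', ← he]
          simpa using hu
      | succ i =>
        refine ⟨i, j, by omega, by omega, hj, ?_⟩
        rw [← he, Function.iterate_succ_apply, ← hu]
    · have hu := hf.uni w u h.symm hd
      refine ⟨i + 1, j, by omega, by omega, hj, ?_⟩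
      rw [← he, Function.iterate_succ_apply, ← hu]

lemma IsPar.dist_eq {G : SimpleGraph V} (hT : G.IsTree) {x : V} {f : V → V} (hf : IsPar G x f)
    (u v : V) : ∃ i j, i + j = G.dist u v ∧ i ≤ G.dist x u ∧ j ≤ G.dist x v ∧
      f^[i] u = f^[j] v := by
  obtain ⟨p, hp⟩ := hT.1.exists_walk_length_eq_dist u v
  obtain ⟨i, j, hij, hi, hj, he⟩ := hf.walk hT p
  refine ⟨i, j, le_antisymm (by omega) ?_, hi, hj, he⟩
  have h1 := hf.dist_iter hT i u hi
  have h2 := hf.dist_iter hT j v hj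
  have h3 := hT.1.dist_triangle (u := u) (v := f^[i] u) (w := v)
  rw [G.dist_comm, ← he] at h2
  omega

lemma iter_mono {f : V → V} {i k : ℕ} (h : i ≤ k) {u v : V} (he : f^[i] u = f^[i] v) :
    f^[k] u = f^[k] v := by
  obtain ⟨m, rfl⟩ := Nat.exists_eq_add_of_le' h
  rw [Function.iterate_add_apply, Function.iterate_add_apply, he]

/-- same-depth vertices -/
lemma IsPar.dist_eq_same {G : SimpleGraph V} (hT : G.IsTree) {x : V} {f : V → V}
    (hf : IsPar G x f) (u v : V) (d : ℕ) (hu : G.dist x u = d) (hv : G.dist x v = d) :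
    ∃ i, G.dist u v = 2 * i ∧ i ≤ d ∧ f^[i] u = f^[i] v := by
  obtain ⟨i, j, hij, hi, hj, he⟩ := hf.dist_eq hT u v
  have h1 := hf.dep_iter i u hi
  have h2 := hf.dep_iter j v hj
  rw [he] at h1
  obtain rfl : i = j := by omega
  exact ⟨i, by omega, by omega, he⟩

lemma IsPar.dist_le_diam {G : SimpleGraph V} (hT : G.IsTree) {x : V} {f : V → V}
    (hf : IsPar G x f) (y : V) (hmax : ∀ a b, G.dist a b ≤ G.dist x y)
    (u v : V) (d : ℕ) (hu : G.dist x u = d) (hv : G.dist x v = d) : G.dist u v ≤ d := by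
  have key : ∀ k z, 1 ≤ k → k ≤ d → d < 2 * k → G.dist x z = d →
      f^[G.dist x y - d + (k - 1)] y = f^[k - 1] z := by
    intro k z hk hkd hdk hz
    have hM := hmax x z
    have hM' := hmax y z
    obtain ⟨i, j, hij, hi, hj, he⟩ := hf.dist_eq hT y z
    have h1 := hf.dep_iter i y hi
    have h2 := hf.dep_iter j z hj
    rw [he] at h1
    have hjk : j ≤ k - 1 := by omega
    obtain ⟨m, hm⟩ := Nat.exists_eq_add_of_le' hjk
    have : G.dist x y - d + (k - 1) = m + i := by omega
    rw [this, hm, Function.iterate_add_apply, Function.iterate_add_apply, he]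
  by_contra hlt
  obtain ⟨i, hi, hid, he⟩ := hf.dist_eq_same hT u v d hu hv
  have e1 := key i u (by omega) hid (by omega) hu
  have e2 := key i v (by omega) hid (by omega) hv
  have e3 := e1.symm.trans e2
  have h1 := hf.dist_iter hT (i - 1) u (by omega)
  have h2 := hf.dist_iter hT (i - 1) v (by omega)
  have h3 := hT.1.dist_triangle (u := u) (v := f^[i - 1] u) (w := v)
  rw [G.dist_comm, ← e3] at h2
  omega

lemma IsPar.card_bound [Fintype V] {G : SimpleGraph V} (hT : G.IsTree) {x : V} {f : V → V}
    (hf : IsPar G x f) (D d : ℕ) (hD : ∀ v, gdeg G v ≤ D + 1) (hD1 : 1 ≤ D) (L : Finset ℕ)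
    (k : ℕ) : ∀ (Z : Finset V), 2 * k ≤ d → (∀ z ∈ Z, G.dist x z = d) →
      (∀ z ∈ Z, ∀ z' ∈ Z, f^[k] z = f^[k] z') → (∀ z ∈ Z, ∀ z' ∈ Z, G.dist z z' ∈ L) →
      Z.card ≤ D ^ (L.filter (fun e => 0 < e ∧ e ≤ 2 * k)).card := by
  classical
  induction k with
  | zero =>
    intro Z _ _ h _
    refine le_trans (Finset.card_le_one.2 fun a ha b hb => by simpa using h a ha b hb) ?_
    exact Nat.one_le_pow _ _ hD1
  | succ k ih =>
    intro Z hk hZ hfk hL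
    by_cases hex : ∃ z ∈ Z, ∃ z' ∈ Z, G.dist z z' = 2 * (k + 1)
    · obtain ⟨z, hz, z', hz', hdz⟩ := hex
      have hmem : 2 * (k + 1) ∈ L := hdz ▸ hL z hz z' hz'
      have hlt : (L.filter (fun e => 0 < e ∧ e ≤ 2 * k)).card + 1 ≤
          (L.filter (fun e => 0 < e ∧ e ≤ 2 * (k + 1))).card := by
        apply Finset.card_lt_card
        refine ⟨fun e he => ?_, fun hsub => ?_⟩
        · simp only [Finset.mem_filter] at he ⊢
          exact ⟨he.1, he.2.1, by omega⟩
        · have := hsub (Finset.mem_filter.2 ⟨hmem, by omega, le_refl _⟩)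
          simp only [Finset.mem_filter] at this
          omega
      have himg : (Z.image f^[k]).card ≤ D := by
        set v := f^[k + 1] z with hv
        have hdv := hf.dep_iter (k + 1) z (by rw [hZ z hz]; omega)
        rw [hZ z hz, ← hv] at hdv
        have hvx : v ≠ x := by
          intro h
          rw [h] at hdv
          simp at hdv
          omega
        have hsub : insert (f v) ((Z.image f^[k] : Finset V) : Set V) ⊆ {u | G.Adj v u} := by
          rintro u (rfl | hu)
          · exact hf.adj v hvx
          · simp only [Finset.coe_image, Set.mem_image, Finset.mem_coe] at hu
            obtain ⟨w, hw, rfl⟩ := hu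
            have hdw := hf.dep_iter k w (by rw [hZ w hw]; omega)
            rw [hZ w hw] at hdw
            have hne : f^[k] w ≠ x := by
              intro h
              rw [h] at hdw
              simp at hdw
              omega
            have := hf.adj _ hne
            rw [← Function.iterate_succ_apply' f, ← hfk z hz w hw] at this
            exact this.symm
        have hnot : f v ∉ ((Z.image f^[k] : Finset V) : Set V) := by
          intro hu
          simp only [Finset.coe_image, Set.mem_image, Finset.mem_coe] at hu
          obtain ⟨w, hw, he⟩ := hu
          have hdw := hf.dep_iter k w (by rw [hZ w hw]; omega)
          rw [hZ w hw, he] at hdw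
          have := hf.dep v hvx
          omega
        have h1 := Set.ncard_le_ncard hsub (Set.toFinite _)
        rw [Set.ncard_insert_of_notMem hnot (Set.toFinite _), Set.ncard_coe_finset] at h1
        have h2 : _ ≤ D + 1 := hD v
        unfold gdeg at h2
        omega
      have := Finset.card_le_mul_card_image (f := f^[k]) Z
        (D ^ (L.filter (fun e => 0 < e ∧ e ≤ 2 * k)).card) (by
          intro b _
          apply ih _ (by omega)
          · intro z hz; exact hZ z (Finset.mem_filter.1 hz).1
          · intro z hz z' hz'
            rw [(Finset.mem_filter.1 hz).2, (Finset.mem_filter.1 hz').2]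
          · intro z hz z' hz'
            exact hL z (Finset.mem_filter.1 hz).1 z' (Finset.mem_filter.1 hz').1)
      calc Z.card ≤ _ := this
        _ ≤ D ^ (L.filter (fun e => 0 < e ∧ e ≤ 2 * k)).card * D := Nat.mul_le_mul_left _ himg
        _ = D ^ ((L.filter (fun e => 0 < e ∧ e ≤ 2 * k)).card + 1) := (pow_succ _ _).symm
        _ ≤ _ := Nat.pow_le_pow_right hD1 hlt
    · push Not at hex
      refine (ih Z (by omega) hZ ?_ hL).trans (Nat.pow_le_pow_right hD1 ?_)
      · intro z hz z' hz'
        obtain ⟨i, hi, hid, he⟩ := hf.dist_eq_same hT z z' d (hZ z hz) (hZ z' hz')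
        have hne := hex z hz z' hz'
        refine iter_mono (i := i) ?_ he
        have h1 := hf.dist_iter hT (k + 1) z (by rw [hZ z hz]; omega)
        have h2 := hf.dist_iter hT (k + 1) z' (by rw [hZ z' hz']; omega)
        have h3 := hT.1.dist_triangle (u := z) (v := f^[k + 1] z) (w := z')
        rw [G.dist_comm, ← hfk z hz z' hz'] at h2
        omega
      · apply Finset.card_le_card
        intro e he
        simp only [Finset.mem_filter] at he ⊢
        exact ⟨he.1, he.2.1, by omega⟩

lemma sum_rank_le (L : Finset ℕ) (D : ℕ) :
    ∑ d ∈ L, D ^ (L.filter (fun e => e < d)).card ≤ ∑ i ∈ Finset.range L.card, D ^ i := by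
  classical
  have hinj : Set.InjOn (fun d => (L.filter (fun e => e < d)).card) (L : Set ℕ) := by
    have key : ∀ a ∈ L, ∀ b ∈ L, a < b →
        (L.filter (fun e => e < a)).card < (L.filter (fun e => e < b)).card := by
      intro a ha b hb hab
      apply Finset.card_lt_card
      refine ⟨fun e he => ?_, fun hsub => ?_⟩
      · simp only [Finset.mem_filter] at he ⊢
        exact ⟨he.1, by omega⟩
      · have := hsub (Finset.mem_filter.2 ⟨ha, hab⟩)
        simp at this
    intro a ha b hb hab
    simp only at hab
    rcases lt_trichotomy a b with h | h | h
    · have := key a ha b hb h; omega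
    · exact h
    · have := key b hb a ha h; omega
  rw [← Finset.sum_image (f := fun i => D ^ i) hinj]
  apply Finset.sum_le_sum_of_subset
  intro i hi
  obtain ⟨d, hd, rfl⟩ := Finset.mem_image.1 hi
  rw [Finset.mem_range]
  apply Finset.card_lt_card
  refine ⟨Finset.filter_subset _ _, fun hsub => ?_⟩
  have := hsub hd
  simp at this

lemma main_nat [Fintype V] (G : SimpleGraph V) (hT : G.IsTree) (D : ℕ) (hD1 : 1 ≤ D)
    (hD : ∀ v, gdeg G v ≤ D + 1) :
    {v | IsLeafV G v}.ncard ≤ ∑ i ∈ Finset.range (lpSet G).ncard, D ^ i := by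
  classical
  haveI : Nonempty V := hT.1.nonempty
  obtain ⟨⟨x, y⟩, hxy⟩ := Finite.exists_max (fun p : V × V => G.dist p.1 p.2)
  have hmax : ∀ a b, G.dist a b ≤ G.dist x y := fun a b => hxy (a, b)
  have hx : IsLeafV G x := by
    unfold IsLeafV gdeg
    rw [Set.ncard_le_one (Set.toFinite _)]
    have : ∀ a, G.Adj x a → G.dist y x = G.dist y a + 1 := by
      intro a ha
      have h1 := hmax a y
      rw [G.dist_comm (u := a), G.dist_comm (u := x)] at h1
      rcases adj_cases G hT y x a ha with h | h <;> omega
    intro a ha b hb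
    exact tree_parent_unique G hT y a b x (SimpleGraph.Adj.symm ha) (SimpleGraph.Adj.symm hb)
      (this a ha) (this b hb)
  obtain ⟨f, hf1, hf2⟩ := exists_parent G hT x
  have hf : IsPar G x f := ⟨fun v hv => (hf1 v hv).1, fun v hv => (hf1 v hv).2, hf2⟩
  have hfin : (lpSet G).Finite := by
    apply Set.Finite.subset (Set.finite_range (fun p : V × V => G.dist p.1 p.2))
    rintro n ⟨u, v, _, _, h⟩
    exact ⟨(u, v), h⟩
  set L := hfin.toFinset with hLdef
  have hLcard : (lpSet G).ncard = L.card := Set.ncard_eq_toFinset_card _ hfin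
  set Z : Finset V := Finset.univ.filter (fun v => IsLeafV G v) with hZ
  have hZc : {v | IsLeafV G v}.ncard = Z.card := by
    rw [← Set.ncard_coe_finset]; simp [hZ]
  have hmemL : ∀ u ∈ Z, ∀ v ∈ Z, G.dist u v ∈ L := by
    intro u hu v hv
    simp only [hZ, Finset.mem_filter, Finset.mem_univ, true_and] at hu hv
    simp only [hLdef, Set.Finite.mem_toFinset]
    exact ⟨u, v, hu, hv, rfl⟩
  have hxZ : x ∈ Z := by simp [hZ, hx]
  have h0L : 0 ∈ L := by simpa using hmemL x hxZ x hxZ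
  rw [hLcard, hZc]
  refine le_trans ?_ (sum_rank_le L D)
  rw [Finset.card_eq_sum_card_fiberwise (f := fun v => G.dist x v) (t := L)
    (fun v hv => hmemL x hxZ v hv)]
  apply Finset.sum_le_sum
  intro d hd
  have hb := hf.card_bound hT D d hD hD1 L (d / 2) (Z.filter (fun v => G.dist x v = d))
    (by omega) (fun z hz => (Finset.mem_filter.1 hz).2)
    (by
      intro z hz z' hz'
      have e1 := (Finset.mem_filter.1 hz).2
      have e2 := (Finset.mem_filter.1 hz').2
      obtain ⟨i, hi, hid, he⟩ := hf.dist_eq_same hT z z' d e1 e2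
      have := hf.dist_le_diam hT y hmax z z' d e1 e2
      exact iter_mono (by omega) he)
    (fun z hz z' hz' => hmemL z (Finset.mem_filter.1 hz).1 z' (Finset.mem_filter.1 hz').1)
  refine hb.trans (Nat.pow_le_pow_right hD1 ?_)
  by_cases hd0 : d = 0
  · subst hd0
    have : (L.filter (fun e => 0 < e ∧ e ≤ 2 * (0 / 2))) = ∅ := by
      ext e; simp; omega
    rw [this]; simp
  have h1 : (L.filter (fun e => 0 < e ∧ e ≤ 2 * (d / 2))).card ≤
      ((insert d (L.filter (fun e => e < d))).erase 0).card := by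
    apply Finset.card_le_card
    intro e he
    simp only [Finset.mem_filter, Finset.mem_erase, Finset.mem_insert] at he ⊢
    refine ⟨by omega, ?_⟩
    by_cases h : e = d
    · exact Or.inl h
    · exact Or.inr ⟨he.1, by omega⟩
  rw [Finset.card_erase_of_mem (by
    simp only [Finset.mem_filter, Finset.mem_insert]; exact Or.inr ⟨h0L, by omega⟩),
    Finset.card_insert_of_notMem (by simp)] at h1
  simpa using h1

end LeafPaths

/-- **Theorem (Di Braccio et al.).** If `T` is a tree of maximum degree `Δ ≥ 3` with `ℓ`
leaves, then the number of different lengths of leaf-to-leaf paths in `T` is at least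
`log_{Δ-1}((Δ-2)ℓ)`. -/
theorem stmt_0 {V : Type*} [Fintype V] (G : SimpleGraph V) (hT : G.IsTree)
    (Δ ℓ : ℕ) (hΔ : Δ = sSup {d | ∃ v, gdeg G v = d}) (hΔ3 : 3 ≤ Δ)
    (hℓ : ℓ = {v | IsLeafV G v}.ncard) :
    Real.logb ((Δ : ℝ) - 1) (((Δ : ℝ) - 2) * (ℓ : ℝ)) ≤ ((lpSet G).ncard : ℝ) := by
  have hdeg : ∀ v, gdeg G v ≤ (Δ - 1) + 1 := by
    intro v
    have hb : BddAbove {d | ∃ v, gdeg G v = d} :=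
      (Set.finite_range (fun v => gdeg G v)).bddAbove
    have := le_csSup hb (show gdeg G v ∈ {d | ∃ v, gdeg G v = d} from ⟨v, rfl⟩)
    omega
  have hmain := main_nat G hT (Δ - 1) (by omega) hdeg
  rw [← hℓ] at hmain
  set n := (lpSet G).ncard with hn
  have hΔR : (3 : ℝ) ≤ Δ := by exact_mod_cast hΔ3
  have hR : (ℓ : ℝ) ≤ ∑ i ∈ Finset.range n, ((Δ : ℝ) - 1) ^ i := by
    have : ((ℓ : ℕ) : ℝ) ≤ ((∑ i ∈ Finset.range n, (Δ - 1) ^ i : ℕ) : ℝ) := by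
      exact_mod_cast hmain
    push_cast [Nat.cast_sub (show 1 ≤ Δ by omega)] at this
    exact this
  have hgeom := geom_sum_mul ((Δ : ℝ) - 1) n
  have hle : ((Δ : ℝ) - 2) * ℓ ≤ ((Δ : ℝ) - 1) ^ n := by nlinarith
  rcases Nat.eq_zero_or_pos ℓ with h0 | hpos
  · subst h0; simp
  have hposR : (0 : ℝ) < ℓ := by exact_mod_cast hpos
  rw [Real.logb_le_iff_le_rpow (by linarith) (by nlinarith)]
  simpa using hle
end

section
/- If s is the degree sequence of some tree T with no vertex of degree 2, then lp(T) ≥ rad(s) − log₂(rad(s)). -/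
open SimpleGraph

lemma gdeg_eq_degree {V : Type*} (G : SimpleGraph V) (v : V) [Fintype (G.neighborSet v)] :
    gdeg G v = G.degree v := by
  rw [← SimpleGraph.card_neighborSet_eq_degree, ← Nat.card_eq_fintype_card]
  rfl

lemma sum_gdeg {V : Type*} [Fintype V] (G : SimpleGraph V) :
    ∑ v, gdeg G v = 2 * Nat.card G.edgeSet := by
  classical
  have := G.sum_degrees_eq_twice_card_edges
  simp_rw [gdeg_eq_degree]
  rw [this, Nat.card_eq_fintype_card, SimpleGraph.edgeFinset_card]

lemma isTree_iff_sum {V : Type*} [Fintype V] (G : SimpleGraph V) (hc : G.Connected) :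
    G.IsTree ↔ ∑ v, gdeg G v + 2 = 2 * Fintype.card V := by
  rw [isTree_iff_connected_and_card, sum_gdeg, Nat.card_eq_fintype_card (α := V)]
  constructor
  · rintro ⟨_, h⟩
    omega
  · intro h
    exact ⟨hc, by omega⟩

lemma degSeq_sum {V : Type*} [Fintype V] (G : SimpleGraph V) :
    (degSeq G).sum = ∑ v, gdeg G v := rfl

lemma degSeq_card {V : Type*} [Fintype V] (G : SimpleGraph V) :
    Multiset.card (degSeq G) = Fintype.card V := by
  simp [degSeq]

/-- attach `k` pendant vertices at `w` -/
def extG {W : Type*} (G : SimpleGraph W) (w : W) (k : ℕ) : SimpleGraph (W ⊕ Fin k) where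
  Adj x y := match x, y with
    | .inl a, .inl b => G.Adj a b
    | .inl a, .inr _ => a = w
    | .inr _, .inl b => b = w
    | .inr _, .inr _ => False
  symm := ⟨by
    rintro (a | a) (b | b) h
    · exact G.adj_symm h
    · exact h
    · exact h
    · exact h⟩
  loopless := ⟨by
    rintro (a | a) h
    · exact G.loopless.irrefl _ h
    · exact h⟩

def extHom {W : Type*} (G : SimpleGraph W) (w : W) (k : ℕ) : G →g extG G w k :=
  ⟨Sum.inl, fun h => h⟩

lemma ext_dist {W : Type*} (G : SimpleGraph W) (hc : G.Connected) (w : W) (k : ℕ) (a b : W) :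
    (extG G w k).dist (Sum.inl a) (Sum.inl b) ≤ G.dist a b := by
  obtain ⟨p, hp⟩ := hc.exists_walk_length_eq_dist a b
  rw [← hp, ← SimpleGraph.Walk.length_map (extHom G w k) p]
  exact dist_le _

lemma ext_conn {W : Type*} (G : SimpleGraph W) (hc : G.Connected) (w : W) (k : ℕ) :
    (extG G w k).Connected := by
  have key : ∀ x, (extG G w k).Reachable (Sum.inl w) x := by
    rintro (a | a)
    · exact (hc w a).map (extHom G w k)
    · have : (extG G w k).Adj (Sum.inl w) (Sum.inr a) := rfl
      exact this.reachable
  exact (connected_iff _).2 ⟨fun x y => (key x).symm.trans (key y), ⟨Sum.inl w⟩⟩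

lemma ext_dist_inr {W : Type*} (G : SimpleGraph W) (hc : G.Connected) (w : W) (k : ℕ) (a : W)
    (j : Fin k) :
    (extG G w k).dist (Sum.inl a) (Sum.inr j) ≤ G.dist a w + 1 := by
  have h1 := ext_dist G hc w k a w
  have h2 : (extG G w k).Adj (Sum.inl w) (Sum.inr j) := rfl
  have h3 := (ext_conn G hc w k).dist_triangle (u := Sum.inl a) (v := Sum.inl w) (w := Sum.inr j)
  rw [dist_eq_one_iff_adj.2 h2] at h3
  omega

lemma ext_gdeg_inr {W : Type*} (G : SimpleGraph W) (w : W) (k : ℕ) (j : Fin k) :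
    gdeg (extG G w k) (Sum.inr j) = 1 := by
  unfold gdeg
  rw [Set.ncard_eq_one]
  refine ⟨Sum.inl w, ?_⟩
  ext (a | a)
  · simp [extG]
  · simp [extG]

lemma ext_gdeg_ne {W : Type*} (G : SimpleGraph W) (w : W) (k : ℕ) (a : W) (h : a ≠ w) :
    gdeg (extG G w k) (Sum.inl a) = gdeg G a := by
  unfold gdeg
  rw [← Set.ncard_image_of_injective {u | G.Adj a u} (Sum.inl_injective (β := Fin k))]
  congr 1
  ext (b | b)
  · simp [extG]
  · simp [extG, h]

lemma ext_gdeg_eq {W : Type*} [Finite W] (G : SimpleGraph W) (w : W) (k : ℕ) :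
    gdeg (extG G w k) (Sum.inl w) = gdeg G w + k := by
  unfold gdeg
  rw [← Set.ncard_image_of_injective {u | G.Adj w u} (Sum.inl_injective (β := Fin k))]
  have : {u | (extG G w k).Adj (Sum.inl w) u} =
      Sum.inl '' {u | G.Adj w u} ∪ Set.range (Sum.inr : Fin k → W ⊕ Fin k) := by
    ext (b | b)
    · simp [extG]
    · simp [extG]
  rw [this, Set.ncard_union_eq]
  · congr 1
    rw [← Set.image_univ, Set.ncard_image_of_injective _ Sum.inr_injective]
    simp
  · rw [Set.disjoint_left]
    rintro _ ⟨a, _, rfl⟩ ⟨b, hb⟩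
    cases hb

lemma ext_degSeq {W : Type*} [Fintype W] (G : SimpleGraph W) (w : W) (k : ℕ)
    (M : Multiset ℕ) (hM : degSeq G = gdeg G w ::ₘ M) :
    degSeq (extG G w k) = (gdeg G w + k) ::ₘ M + Multiset.replicate k 1 := by
  classical
  have h1 : (Finset.univ : Finset W).val = w ::ₘ ((Finset.univ : Finset W).erase w).val := by
    rw [Finset.erase_val, Multiset.cons_erase (Finset.mem_univ_val w)]
  have h2 : M = ((Finset.univ : Finset W).erase w).val.map (gdeg G) := by
    unfold degSeq at hM
    rw [h1, Multiset.map_cons, Multiset.cons_inj_right] at hM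
    exact hM.symm
  unfold degSeq
  rw [← Finset.univ_disjSum_univ, Finset.val_disjSum, Multiset.disjSum, Multiset.map_add,
    Multiset.map_map, Multiset.map_map, h1, Multiset.map_cons, h2]
  congr 1
  · simp only [Function.comp, ext_gdeg_eq]
    congr 1
    apply Multiset.map_congr rfl
    intro x hx
    exact ext_gdeg_ne G w k x (Finset.ne_of_mem_erase hx)
  · have : gdeg (extG G w k) ∘ Sum.inr = fun _ => 1 := funext (ext_gdeg_inr G w k)
    rw [this]
    simp

/-- number of leaves minus two -/
def ex (M : Multiset ℕ) : ℕ := (M.map (fun d => d - 2)).sum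

def SS (M : Multiset ℕ) (h a : ℕ) : Prop :=
  ∃ (W : Type) (_ : Fintype W) (G : SimpleGraph W) (c : W) (A : Finset W), G.Connected ∧
    degSeq G = M + Multiset.replicate (2 + ex M) 1 ∧ a ≤ A.card ∧
    (∀ x ∈ A, gdeg G x = 1 ∧ G.dist c x ≤ h) ∧ ∀ w, G.dist c w ≤ h + 1

lemma SS_step (M : Multiset ℕ) (h a d : ℕ) (hd : 2 ≤ d) (H : SS M h (a + 1)) :
    SS (d ::ₘ M) h a := by
  classical
  obtain ⟨W, _, G, c, A, hc, hs, hA, hA', hw⟩ := H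
  obtain ⟨w, hwA⟩ : A.Nonempty := Finset.card_pos.1 (by omega)
  obtain ⟨k, rfl⟩ : ∃ k, d = k + 1 := ⟨d - 1, by omega⟩
  refine ⟨W ⊕ Fin k, inferInstance, extG G w k, Sum.inl c,
    (A.erase w).map ⟨Sum.inl, Sum.inl_injective⟩, ext_conn G hc w k, ?_, ?_, ?_, ?_⟩
  · rw [ext_degSeq G w k (M + Multiset.replicate (1 + ex M) 1), (hA' w hwA).1]
    · have : ex ((k + 1) ::ₘ M) = (k - 1) + ex M := by
        simp [ex]
      rw [this, show 2 + (k - 1 + ex M) = 1 + ex M + k by omega,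
        Multiset.replicate_add _ k, add_comm 1 k, Multiset.cons_add, Multiset.cons_add, add_assoc]
    · rw [hs, (hA' w hwA).1, show 2 + ex M = (1 + ex M) + 1 by omega,
        Multiset.replicate_succ, Multiset.add_cons]
  · rw [Finset.card_map, Finset.card_erase_of_mem hwA]
    omega
  · intro x hx
    rw [Finset.mem_map] at hx
    obtain ⟨y, hy, rfl⟩ := hx
    rw [Finset.mem_erase] at hy
    refine ⟨?_, ?_⟩
    · exact (ext_gdeg_ne G w k y hy.1).trans (hA' y hy.2).1
    · exact (ext_dist G hc w k c y).trans (hA' y hy.2).2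
  · rintro (x | x)
    · exact (ext_dist G hc w k c x).trans (hw x)
    · exact (ext_dist_inr G hc w k c x).trans (by have := (hA' w hwA).2; omega)

lemma SS_steps (M J : Multiset ℕ) (h a : ℕ) (hJ : ∀ d ∈ J, 2 ≤ d)
    (H : SS M h (a + Multiset.card J)) : SS (M + J) h a := by
  induction J using Multiset.induction_on generalizing M with
  | empty => simpa using H
  | cons d J ih =>
    have := SS_step M h (a + Multiset.card J) d (hJ d (by simp)) (by simpa [add_assoc] using H)
    have := ih (d ::ₘ M) (fun x hx => hJ x (by simp [hx])) this
    rwa [Multiset.cons_add, ← Multiset.add_cons] at this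

def TT (M : Multiset ℕ) (h : ℕ) : Prop :=
  ∃ (W : Type) (_ : Fintype W) (G : SimpleGraph W) (c : W) (A : Finset W), G.Connected ∧
    degSeq G = M + Multiset.replicate (2 + ex M) 1 ∧ 1 + ex M ≤ A.card ∧
    (∀ x ∈ A, gdeg G x = 1 ∧ G.dist c x ≤ h) ∧ ∀ w, G.dist c w ≤ max h 1

lemma TT_step (M J : Multiset ℕ) (h : ℕ) (hJ : ∀ d ∈ J, 2 ≤ d) (hc : Multiset.card J ≤ 1 + ex M)
    (H : TT M h) : TT (M + J) (h + 1) := by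
  classical
  obtain ⟨W, _, G, c, A, hc, hs, hA, hA', hw⟩ := H
  have : SS (M + J) h 0 := by
    apply SS_steps _ _ _ _ hJ
    refine ⟨W, inferInstance, G, c, A, hc, hs, by omega, hA', fun w => (hw w).trans (by omega)⟩
  obtain ⟨W, _, G, c, A, hc, hs, hA, hA', hw⟩ := this
  refine ⟨W, inferInstance, G, c, Finset.univ.filter (fun x => gdeg G x = 1), hc, hs, ?_, ?_, ?_⟩
  · have h1 : (degSeq G).count 1 = (Finset.univ.filter (fun x => gdeg G x = 1)).card := by
      unfold degSeq
      rw [Multiset.count_map, Finset.card_def, Finset.filter_val]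
      congr 1
      apply Multiset.filter_congr
      intro x _
      exact eq_comm
    rw [← h1, hs, Multiset.count_add, Multiset.count_replicate_self]
    omega
  · intro x hx
    exact ⟨(Finset.mem_filter.1 hx).2, hw x⟩
  · intro w
    exact (hw w).trans (by omega)

lemma TT_zero : TT 0 0 := by
  refine ⟨Bool, inferInstance, ⊤, true, {true}, connected_top, ?_, ?_, ?_, ?_⟩
  · have : ∀ x : Bool, gdeg (⊤ : SimpleGraph Bool) x = 1 := by
      intro x
      rw [gdeg_eq_degree]
      simp
    unfold degSeq
    rw [Multiset.map_congr rfl (g := fun _ => 1) (fun x _ => this x)]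
    simp [ex]
  · simp [ex]
  · intro x hx
    rw [gdeg_eq_degree]
    simp at hx
    simp [hx]
  · intro w
    cases w <;> simp [dist_top]

lemma iso_gdeg {V W : Type*} {G : SimpleGraph V} {H : SimpleGraph W} (f : G ≃g H) (v : V) :
    gdeg H (f v) = gdeg G v := by
  unfold gdeg
  rw [← Set.ncard_image_of_injective {u | G.Adj v u} f.injective]
  congr 1
  ext x
  constructor
  · intro hx
    refine ⟨f.symm x, ?_, by simp⟩
    have : H.Adj (f v) (f (f.symm x)) := by simpa using hx
    exact f.map_adj_iff.1 this
  · rintro ⟨y, hy, rfl⟩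
    exact f.map_adj_iff.2 hy

lemma radSeq_le {V : Type*} [Fintype V] (G : SimpleGraph V) (hT : G.IsTree) (c : V) (h : ℕ)
    (hh : ∀ w, G.dist c w ≤ h) (s : Multiset ℕ) (hs : degSeq G = s) : radSeq s ≤ h := by
  classical
  have hcard : Fintype.card V = Multiset.card s := by rw [← hs, degSeq_card]
  let e : V ≃ Fin (Multiset.card s) := Fintype.equivFinOfCardEq hcard
  let H : SimpleGraph (Fin (Multiset.card s)) := G.map e.toEmbedding
  let f : G ≃g H := SimpleGraph.Iso.map e G
  have hH : H.IsTree := f.isTree_iff.1 hT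
  have h1 : degSeq H = s := by
    refine Eq.trans ?_ hs
    unfold degSeq
    have : (Finset.univ : Finset (Fin (Multiset.card s))).val = (Finset.univ : Finset V).val.map f := by
      rw [← Finset.map_univ_equiv e, Finset.map_val]
      rfl
    rw [this, Multiset.map_map]
    exact Multiset.map_congr rfl (fun x _ => iso_gdeg f x)
  have h2 : ecc H (f c) ≤ h := by
    unfold ecc
    refine csSup_le (s := {d | ∃ u, H.dist (f c) u = d}) ⟨_, f c, rfl⟩ ?_
    rintro _ ⟨u, rfl⟩
    obtain ⟨p, hp⟩ := hT.connected.exists_walk_length_eq_dist c (f.symm u)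
    have h3 := dist_le (p.map f.toHom)
    rw [SimpleGraph.Walk.length_map, hp] at h3
    have h4 : f.toHom (f.symm u) = u := f.apply_symm_apply u
    rw [h4] at h3
    exact h3.trans (hh _)
  have h3 : treeRadius H ≤ h := le_trans (Nat.sInf_le ⟨f c, rfl⟩) h2
  exact le_trans (Nat.sInf_le ⟨H, hH, h1, rfl⟩) h3

lemma TT_rad (M : Multiset ℕ) (h : ℕ) (hM : ∀ d ∈ M, 2 ≤ d) (H : TT M h) :
    radSeq (M + Multiset.replicate (2 + ex M) 1) ≤ max h 1 := by
  obtain ⟨W, _, G, c, A, hc, hs, hA, hA', hw⟩ := H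
  refine radSeq_le G ?_ c _ hw _ hs
  rw [isTree_iff_sum G hc, ← degSeq_sum, ← degSeq_card G, hs]
  have : M.sum = ex M + 2 * Multiset.card M := by
    clear hs hA
    induction M using Multiset.induction_on with
    | empty => simp [ex]
    | cons d M ih =>
      have := ih (fun x hx => hM x (by simp [hx]))
      have h2 := hM d (by simp)
      simp [ex] at this ⊢
      omega
  simp
  omega

lemma tree_path_len {V : Type*} {G : SimpleGraph V} (hT : G.IsTree) {u v : V} (p : G.Walk u v)
    (hp : p.IsPath) : G.dist u v = p.length := by
  obtain ⟨q, hq, hl⟩ := hT.connected.exists_path_of_dist u v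
  rw [← hl, (hT.existsUnique_path u v).unique hq hp]

lemma branch_dist {V : Type*} {G : SimpleGraph V} (hT : G.IsTree) {v u₁ u₂ x₁ x₂ : V}
    (h1 : G.Adj v u₁) (h2 : G.Adj v u₂) (hne : u₁ ≠ u₂)
    (d1 : G.dist v x₁ = G.dist u₁ x₁ + 1) (d2 : G.dist v x₂ = G.dist u₂ x₂ + 1) :
    G.dist x₁ x₂ = G.dist v x₁ + G.dist v x₂ := by
  classical
  obtain ⟨q₁, hq₁⟩ := hT.connected.exists_walk_length_eq_dist u₁ x₁
  obtain ⟨q₂, hq₂⟩ := hT.connected.exists_walk_length_eq_dist u₂ x₂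
  have p1 : (Walk.cons h1 q₁).IsPath := Walk.isPath_of_length_eq_dist _ (by simp [hq₁, d1])
  have p2 : (Walk.cons h2 q₂).IsPath := Walk.isPath_of_length_eq_dist _ (by simp [hq₂, d2])
  have hp : ((Walk.cons h1 q₁).reverse.append (Walk.cons h2 q₂)).IsPath := by
    rw [Walk.isPath_def, Walk.support_append, List.nodup_append']
    refine ⟨((Walk.isPath_reverse_iff _).2 p1).support_nodup, p2.support_nodup.tail, ?_⟩
    intro y hy1 hy2
    have hy1' : y ∈ (Walk.cons h1 q₁).support := by
      rw [Walk.support_reverse, List.mem_reverse] at hy1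
      exact hy1
    have hy2' : y ∈ (Walk.cons h2 q₂).support := List.mem_of_mem_tail hy2
    have hyv : y ≠ v := by
      rintro rfl
      have := p2.support_nodup
      simp at this hy2
      exact this.1 hy2
    have e := (hT.existsUnique_path v y).unique (p1.takeUntil hy1') (p2.takeUntil hy2')
    have e1 := Walk.snd_takeUntil hyv _ hy1'
    have e2 := Walk.snd_takeUntil hyv _ hy2'
    rw [e, e2] at e1
    simp at e1
    exact hne e1.symm
  rw [tree_path_len hT _ hp]
  simp [hq₁, hq₂, d1, d2]

lemma exists_parent_s1 {V : Type*} {G : SimpleGraph V} (hc : G.Connected) {r u : V} {k : ℕ}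
    (h : G.dist r u = k + 1) : ∃ v, G.Adj v u ∧ G.dist r v = k := by
  obtain ⟨p, hp⟩ := hc.exists_walk_length_eq_dist u r
  rw [dist_comm, h] at hp
  cases p with
  | nil => simp at hp
  | @cons _ v _ hadj q =>
    simp at hp
    refine ⟨v, hadj.symm, ?_⟩
    have h1 := dist_le q
    rw [dist_comm] at h1
    have h2 := hc.dist_triangle (u := r) (v := v) (w := u)
    rw [dist_eq_one_iff_adj.2 hadj.symm] at h2
    omega

section
open Classical

variable {V : Type*} [Fintype V]

noncomputable def Xs (G : SimpleGraph V) (r : V) (C : Finset V) (k : ℕ) : Finset V :=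
  Finset.univ.filter (fun v => G.dist r v = k ∧ ∃ x ∈ C, G.dist r v + G.dist v x = G.dist r x)

noncomputable def Ks (G : SimpleGraph V) (r : V) (C : Finset V) (v : V) : Finset V :=
  (Xs G r C (G.dist r v + 1)).filter (fun u => G.Adj v u)

noncomputable def Bs (G : SimpleGraph V) (r : V) (C : Finset V) (k : ℕ) : Finset V :=
  (Xs G r C k).filter (fun v => 2 ≤ (Ks G r C v).card)

noncomputable def BB (G : SimpleGraph V) (r : V) (C : Finset V) (k : ℕ) : Finset V :=
  Finset.univ.filter (fun v => G.dist r v < k ∧ v ∈ Bs G r C (G.dist r v))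

lemma gdeg_eq_card (G : SimpleGraph V) (v : V) :
    gdeg G v = (Finset.univ.filter (fun u => G.Adj v u)).card := by
  unfold gdeg
  rw [← Set.ncard_coe_finset]
  congr 1
  ext; simp

lemma Ks_card (G : SimpleGraph V) (hT : G.IsTree) (r : V) (hr : gdeg G r = 1) (C : Finset V) (v : V)
    (hv : 2 ≤ (Ks G r C v).card) : (Ks G r C v).card + 1 ≤ gdeg G v := by
  have hsub : Ks G r C v ⊆ Finset.univ.filter (fun u => G.Adj v u) := by
    intro u hu
    simp [Ks] at hu ⊢
    exact hu.2
  have h0 : v ≠ r := by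
    rintro rfl
    have := Finset.card_le_card hsub
    rw [← gdeg_eq_card] at this
    omega
  have hpos := hT.connected.pos_dist_of_ne h0.symm
  obtain ⟨w, hw, hwd⟩ := exists_parent_s1 hT.connected (r := r) (u := v) (k := G.dist r v - 1) (by omega)
  have : insert w (Ks G r C v) ⊆ Finset.univ.filter (fun u => G.Adj v u) := by
    intro u hu
    rw [Finset.mem_insert] at hu
    rcases hu with rfl | hu
    · simpa using hw.symm
    · exact hsub hu
  have h2 := Finset.card_le_card this
  rw [← gdeg_eq_card, Finset.card_insert_of_notMem] at h2
  · exact h2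
  · intro h
    simp [Ks, Xs] at h
    omega

lemma BB_succ (G : SimpleGraph V) (r : V) (C : Finset V) (k : ℕ) :
    ∃ h, BB G r C (k + 1) = (BB G r C k).disjUnion (Bs G r C k) h := by
  refine ⟨?_, ?_⟩
  · rw [Finset.disjoint_left]
    intro v hv hv'
    simp [BB] at hv
    simp [Bs, Xs] at hv'
    omega
  · ext v
    rw [Finset.mem_disjUnion]
    have : v ∈ Bs G r C k → G.dist r v = k := by
      intro hv'
      simp [Bs, Xs] at hv'
      exact hv'.1.1
    simp only [BB, Finset.mem_filter, Finset.mem_univ, true_and]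
    constructor
    · rintro ⟨h1, h2⟩
      by_cases h : G.dist r v < k
      · exact Or.inl ⟨h, h2⟩
      · have : G.dist r v = k := by omega
        rw [this] at h2
        exact Or.inr h2
    · rintro (⟨h1, h2⟩ | h)
      · exact ⟨by omega, h2⟩
      · have h3 := this h
        subst h3
        exact ⟨by omega, h⟩

lemma Xs_card (G : SimpleGraph V) (hT : G.IsTree) (r : V) (hr : gdeg G r = 1) (C : Finset V)
    (k : ℕ) : (Xs G r C k).card ≤ 1 + ∑ v ∈ BB G r C k, (gdeg G v - 2) := by
  induction k with
  | zero =>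
    have : Xs G r C 0 ⊆ {r} := by
      intro v hv
      simp only [Xs, Finset.mem_filter, Finset.mem_univ, true_and] at hv
      have := (hT.connected.dist_eq_zero_iff).1 hv.1
      simp [this]
    have := Finset.card_le_card this
    simp at this
    omega
  | succ k ih =>
    obtain ⟨hd, h1⟩ := BB_succ G r C k
    rw [h1, Finset.sum_disjUnion]
    have hsub : Xs G r C (k + 1) ⊆ (Xs G r C k).biUnion (Ks G r C) := by
      intro u hu
      have hu' := hu
      simp only [Xs, Finset.mem_filter, Finset.mem_univ, true_and] at hu'
      obtain ⟨hk, x, hx, hdx⟩ := hu'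
      obtain ⟨v, hv, hvd⟩ := exists_parent_s1 hT.connected hk
      rw [Finset.mem_biUnion]
      refine ⟨v, ?_, ?_⟩
      · simp only [Xs, Finset.mem_filter, Finset.mem_univ, true_and]
        refine ⟨hvd, x, hx, ?_⟩
        have t1 := hT.connected.dist_triangle (u := v) (v := u) (w := x)
        have t2 := hT.connected.dist_triangle (u := r) (v := v) (w := x)
        rw [dist_eq_one_iff_adj.2 hv] at t1
        omega
      · simp only [Ks, Finset.mem_filter]
        rw [hvd]
        exact ⟨hu, hv⟩
    have h2 := (Finset.card_le_card hsub).trans Finset.card_biUnion_le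
    have h3 : ∑ v ∈ Xs G r C k, (Ks G r C v).card ≤
        ∑ v ∈ Xs G r C k, (1 + if 2 ≤ (Ks G r C v).card then gdeg G v - 2 else 0) := by
      apply Finset.sum_le_sum
      intro v _
      split_ifs with h
      · have := Ks_card G hT r hr C v h
        omega
      · omega
    rw [Finset.sum_add_distrib, ← Finset.sum_filter] at h3
    simp only [Finset.sum_const, smul_eq_mul, mul_one] at h3
    have h4 : ∑ v ∈ Bs G r C k, (gdeg G v - 2) =
      ∑ a ∈ Xs G r C k with 2 ≤ (Ks G r C a).card, (gdeg G a - 2) := rfl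
    omega

lemma ex_map (G : SimpleGraph V) (B : Finset V) :
    ex (B.val.map (gdeg G)) = ∑ v ∈ B, (gdeg G v - 2) := by
  unfold ex
  rw [Multiset.map_map]
  rfl

/-- branching levels below `k` -/
noncomputable def Lv (G : SimpleGraph V) (r : V) (C : Finset V) (k : ℕ) : Finset ℕ :=
  (Finset.range k).filter (fun i => (Bs G r C i).Nonempty)

lemma Bs_gdeg (G : SimpleGraph V) (hT : G.IsTree) (r : V) (hr : gdeg G r = 1) (C : Finset V)
    (k : ℕ) (v : V) (hv : v ∈ Bs G r C k) : 3 ≤ gdeg G v := by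
  have h := (Finset.mem_filter.1 hv).2
  have := Ks_card G hT r hr C v h
  omega

lemma TT_BB (G : SimpleGraph V) (hT : G.IsTree) (r : V) (hr : gdeg G r = 1) (C : Finset V)
    (k : ℕ) : TT ((BB G r C k).val.map (gdeg G)) (Lv G r C k).card := by
  induction k with
  | zero =>
    have : BB G r C 0 = ∅ := by simp [BB]
    simpa [this, Lv] using TT_zero
  | succ k ih =>
    obtain ⟨hd, h1⟩ := BB_succ G r C k
    by_cases hB : (Bs G r C k).Nonempty
    · have hL : (Lv G r C (k + 1)).card = (Lv G r C k).card + 1 := by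
        unfold Lv
        rw [Finset.range_add_one, Finset.filter_insert, if_pos hB, Finset.card_insert_of_notMem]
        simp
      rw [hL, h1, Finset.disjUnion_val, Multiset.map_add]
      apply TT_step _ _ _ _ _ ih
      · intro d hd
        rw [Multiset.mem_map] at hd
        obtain ⟨v, hv, rfl⟩ := hd
        have := Bs_gdeg G hT r hr C k v hv
        omega
      · rw [ex_map, Multiset.card_map]
        exact (Finset.card_le_card (Finset.filter_subset _ _)).trans (Xs_card G hT r hr C k)
    · have hL : Lv G r C (k + 1) = Lv G r C k := by
        unfold Lv
        rw [Finset.range_add_one, Finset.filter_insert, if_neg hB]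
      rw [Finset.not_nonempty_iff_eq_empty] at hB
      rw [hL, h1, Finset.disjUnion_val, hB]
      simpa using ih

lemma lp_finite (G : SimpleGraph V) : (lpSet G).Finite := by
  apply (Set.finite_range (fun p : V × V => G.dist p.1 p.2)).subset
  rintro _ ⟨u, v, _, _, rfl⟩
  exact ⟨(u, v), rfl⟩

lemma lp_ge (G : SimpleGraph V) (hT : G.IsTree) (r : V) (C : Finset V)
    (d : ℕ) (hr : gdeg G r = 1) (hC : ∀ x ∈ C, IsLeafV G x ∧ G.dist r x = d) :
    (Lv G r C d).card + 1 ≤ (lpSet G).ncard := by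
  have hsub : (↑(insert 0 ((Lv G r C d).image (fun k => 2 * (d - k)))) : Set ℕ) ⊆ lpSet G := by
    intro n hn
    rw [Finset.mem_coe, Finset.mem_insert] at hn
    rcases hn with rfl | hn
    · exact ⟨r, r, hr.le, hr.le, by simp⟩
    · rw [Finset.mem_image] at hn
      obtain ⟨k, hk, rfl⟩ := hn
      rw [Lv, Finset.mem_filter] at hk
      obtain ⟨hkd, v, hv⟩ := hk
      rw [Bs, Finset.mem_filter] at hv
      obtain ⟨hvX, hvK⟩ := hv
      have hvk : G.dist r v = k := by
        simp only [Xs, Finset.mem_filter] at hvX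
        exact hvX.2.1
      obtain ⟨u₁, hu₁, u₂, hu₂, hne⟩ := Finset.one_lt_card.1 hvK
      have key : ∀ u ∈ Ks G r C v, G.Adj v u ∧ ∃ x ∈ C, G.dist v x = G.dist u x + 1 ∧
          G.dist v x = d - k := by
        intro u hu
        simp only [Ks, Xs, Finset.mem_filter, Finset.mem_univ, true_and] at hu
        obtain ⟨⟨hud, x, hx, hdx⟩, hadj⟩ := hu
        refine ⟨hadj, x, hx, ?_⟩
        have t1 := hT.connected.dist_triangle (u := v) (v := u) (w := x)
        have t2 := hT.connected.dist_triangle (u := r) (v := v) (w := x)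
        rw [dist_eq_one_iff_adj.2 hadj] at t1
        have := (hC x hx).2
        omega
      obtain ⟨a1, x1, hx1, e1, f1⟩ := key u₁ hu₁
      obtain ⟨a2, x2, hx2, e2, f2⟩ := key u₂ hu₂
      refine ⟨x1, x2, (hC x1 hx1).1, (hC x2 hx2).1, ?_⟩
      rw [branch_dist hT a1 a2 hne e1 e2, f1, f2]
      omega
  have h1 := Set.ncard_le_ncard hsub (lp_finite G)
  rw [Set.ncard_coe_finset, Finset.card_insert_of_notMem, Finset.card_image_of_injOn] at h1
  · exact h1
  · intro a ha b hb hab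
    simp [Lv] at ha hb hab
    omega
  · intro h
    rw [Finset.mem_image] at h
    obtain ⟨k, hk, h⟩ := h
    simp [Lv] at hk
    omega

lemma TT_double (G : SimpleGraph V) (I B : Finset V) (hBI : B ⊆ I) (hI : ∀ v ∈ I, 3 ≤ gdeg G v)
    (h t : ℕ) (H : TT (B.val.map (gdeg G)) h) :
    ∃ B' ⊆ I, TT (B'.val.map (gdeg G)) (h + t) ∧
      (B' = I ∨ 2 ^ t * (1 + ∑ v ∈ B, (gdeg G v - 2)) ≤ 1 + ∑ v ∈ B', (gdeg G v - 2)) := by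
  induction t with
  | zero => exact ⟨B, hBI, H, Or.inr (by simp)⟩
  | succ t ih =>
    obtain ⟨B', hB', HT, hor⟩ := ih
    obtain ⟨J, hJ, hJc⟩ := Finset.exists_subset_card_eq
      (s := I \ B') (n := min (I \ B').card (1 + ∑ v ∈ B', (gdeg G v - 2))) (min_le_left _ _)
    have hdis : Disjoint B' J := by
      rw [Finset.disjoint_left]
      intro x hx hxJ
      exact (Finset.mem_sdiff.1 (hJ hxJ)).2 hx
    have hJI : J ⊆ I := hJ.trans Finset.sdiff_subset
    refine ⟨B'.disjUnion J hdis, ?_, ?_, ?_⟩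
    · intro x hx
      rw [Finset.mem_disjUnion] at hx
      exact hx.elim (fun h => hB' h) (fun h => hJI h)
    · rw [Finset.disjUnion_val, Multiset.map_add]
      apply TT_step _ _ _ _ _ HT
      · intro d hd
        rw [Multiset.mem_map] at hd
        obtain ⟨v, hv, rfl⟩ := hd
        have := hI v (hJI hv)
        omega
      · rw [ex_map, Multiset.card_map]
        exact hJc.trans_le (min_le_right _ _)
    · by_cases hle : (I \ B').card ≤ 1 + ∑ v ∈ B', (gdeg G v - 2)
      · left
        rw [min_eq_left hle] at hJc
        have := Finset.eq_of_subset_of_card_le hJ hJc.ge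
        subst this
        rw [Finset.disjUnion_eq_union]
        exact Finset.union_sdiff_of_subset hB'
      · right
        rw [min_eq_right (by omega)] at hJc
        rw [Finset.sum_disjUnion]
        have h1 : J.card ≤ ∑ v ∈ J, (gdeg G v - 2) := by
          rw [Finset.card_eq_sum_ones]
          apply Finset.sum_le_sum
          intro v hv
          have := hI v (hJI hv)
          omega
        rcases hor with rfl | hor
        · simp at hle
        · rw [pow_succ]
          nlinarith

lemma rad_bound (G : SimpleGraph V) (hT : G.IsTree) (h2 : ∀ v, gdeg G v ≠ 2)
    (hn : 2 ≤ Fintype.card V) : 2 ≤ (lpSet G).ncard ∧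
    radSeq (degSeq G) ≤ max ((lpSet G).ncard - 1 + Nat.clog 2 ((lpSet G).ncard - 1)) 1 := by
  have hpos : ∀ v, 1 ≤ gdeg G v := by
    intro v
    have : Nontrivial V := Fintype.one_lt_card_iff_nontrivial.1 hn
    rw [gdeg_eq_degree]
    exact hT.connected.preconnected.degree_pos_of_nontrivial v
  set I : Finset V := Finset.univ.filter (fun v => 3 ≤ gdeg G v) with hI
  set L : Finset V := Finset.univ.filter (fun v => gdeg G v = 1) with hL
  have hIL : ∃ hd, (Finset.univ : Finset V) = I.disjUnion L hd := by
    refine ⟨?_, ?_⟩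
    · rw [Finset.disjoint_left]
      intro x hx hx'
      simp [hI, hL] at hx hx'
      omega
    · ext x
      have := hpos x
      have := h2 x
      simp [hI, hL]
      omega
  obtain ⟨hd, huniv⟩ := hIL
  have hsI : ∑ v ∈ I, gdeg G v = ∑ v ∈ I, (gdeg G v - 2) + 2 * I.card := by
    rw [mul_comm, ← smul_eq_mul, ← Finset.sum_const, ← Finset.sum_add_distrib]
    apply Finset.sum_congr rfl
    intro x hx
    simp [hI] at hx
    omega
  have hsL : ∑ v ∈ L, gdeg G v = L.card := by
    rw [Finset.card_eq_sum_ones]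
    apply Finset.sum_congr rfl
    intro x hx
    simp [hL] at hx
    omega
  have hLc : L.card = 2 + ∑ v ∈ I, (gdeg G v - 2) := by
    have h1 := (isTree_iff_sum G hT.connected).1 hT
    have h3 : Fintype.card V = I.card + L.card := by
      rw [← Finset.card_univ, huniv, Finset.card_disjUnion]
    rw [h3, huniv, Finset.sum_disjUnion, hsI, hsL] at h1
    omega
  have hdeg : degSeq G = I.val.map (gdeg G) +
      Multiset.replicate (2 + ex (I.val.map (gdeg G))) 1 := by
    unfold degSeq
    rw [huniv, Finset.disjUnion_val, Multiset.map_add, ex_map, ← hLc]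
    congr 1
    rw [Multiset.eq_replicate]
    refine ⟨by simp, ?_⟩
    intro b hb
    rw [Multiset.mem_map] at hb
    obtain ⟨v, hv, rfl⟩ := hb
    exact (Finset.mem_filter.1 hv).2
  obtain ⟨r, hrL⟩ : L.Nonempty := Finset.card_pos.1 (by omega)
  have hr : gdeg G r = 1 := (Finset.mem_filter.1 hrL).2
  have hLe : (L.erase r).card = 1 + ∑ v ∈ I, (gdeg G v - 2) := by
    rw [Finset.card_erase_of_mem hrL]
    omega
  set P : Finset ℕ := (lp_finite G).toFinset.erase 0 with hP
  have h0 : 0 ∈ (lp_finite G).toFinset := by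
    rw [Set.Finite.mem_toFinset]
    exact ⟨r, r, hr.le, hr.le, by simp⟩
  have hPc : P.card = (lpSet G).ncard - 1 := by
    rw [hP, Finset.card_erase_of_mem h0, Set.ncard_eq_toFinset_card _ (lp_finite G)]
  have hmaps : ∀ a ∈ L.erase r, G.dist r a ∈ P := by
    intro a ha
    rw [Finset.mem_erase] at ha
    rw [hP, Finset.mem_erase, Set.Finite.mem_toFinset]
    refine ⟨(hT.connected.pos_dist_of_ne ha.1.symm).ne', r, a, hr.le, ?_, rfl⟩
    exact (Finset.mem_filter.1 ha.2).2.le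
  obtain ⟨a0, ha0⟩ : (L.erase r).Nonempty := Finset.card_pos.1 (by omega)
  have hPne : P.Nonempty := ⟨_, hmaps a0 ha0⟩
  have hPpos := Finset.card_pos.2 hPne
  obtain ⟨d, hdP, hCd⟩ : ∃ d ∈ P, (L.erase r).card ≤
      P.card * ((L.erase r).filter (fun x => G.dist r x = d)).card := by
    by_contra hcon
    push Not at hcon
    have h1 := Finset.card_eq_sum_card_fiberwise hmaps
    have h3 := Finset.sum_lt_sum_of_nonempty hPne hcon
    rw [← Finset.mul_sum, ← h1, Finset.sum_const, smul_eq_mul] at h3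
    exact lt_irrefl _ h3
  set C := (L.erase r).filter (fun x => G.dist r x = d) with hC
  have hCC : ∀ x ∈ C, IsLeafV G x ∧ G.dist r x = d := by
    intro x hx
    rw [hC, Finset.mem_filter, Finset.mem_erase] at hx
    exact ⟨(Finset.mem_filter.1 hx.1.2).2.le, hx.2⟩
  have hCX : C ⊆ Xs G r C d := by
    intro x hx
    simp only [Xs, Finset.mem_filter, Finset.mem_univ, true_and]
    exact ⟨(hCC x hx).2, x, hx, by simp⟩
  have hm := (Finset.card_le_card hCX).trans (Xs_card G hT r hr C d)
  have hlp := lp_ge G hT r C d hr hCC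
  have hBI : BB G r C d ⊆ I := by
    intro v hv
    simp only [BB, Finset.mem_filter] at hv
    rw [hI, Finset.mem_filter]
    exact ⟨Finset.mem_univ _, Bs_gdeg G hT r hr C _ v hv.2.2⟩
  have hI3 : ∀ v ∈ I, 3 ≤ gdeg G v := fun v hv => (Finset.mem_filter.1 hv).2
  obtain ⟨B', hB'I, HT, hor⟩ := TT_double G I (BB G r C d) hBI hI3 _ (Nat.clog 2 P.card)
    (TT_BB G hT r hr C d)
  have hBeq : B' = I := by
    rcases hor with h | h
    · exact h
    · have h3 := Nat.le_pow_clog (b := 2) (by norm_num) P.card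
      have h4 : (L.erase r).card ≤ 1 + ∑ v ∈ B', (gdeg G v - 2) :=
        hCd.trans ((Nat.mul_le_mul h3 hm).trans h)
      rw [hLe, ← Finset.sum_sdiff hB'I] at h4
      have h5 : ∑ v ∈ I \ B', (gdeg G v - 2) = 0 := by omega
      rw [Finset.sum_eq_zero_iff] at h5
      apply Finset.Subset.antisymm hB'I
      intro x hx
      by_contra hx'
      have := h5 x (Finset.mem_sdiff.2 ⟨hx, hx'⟩)
      have := hI3 x hx
      omega
  rw [hBeq] at HT
  have hR := TT_rad _ _ (by
    intro d hd
    rw [Multiset.mem_map] at hd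
    obtain ⟨v, hv, rfl⟩ := hd
    have := hI3 v hv
    omega) HT
  rw [← hdeg] at hR
  refine ⟨by omega, hR.trans ?_⟩
  rw [hPc]
  apply max_le_max _ le_rfl
  omega

end

lemma final_arith (R p : ℕ) (hp : 2 ≤ p) (hR : R ≤ max (p - 1 + Nat.clog 2 (p - 1)) 1) :
    (R : ℝ) - Real.logb 2 R ≤ p := by
  have hlog : 0 ≤ Real.logb 2 R := by
    rcases Nat.eq_zero_or_pos R with rfl | h
    · simp
    · exact Real.logb_nonneg (by norm_num) (by exact_mod_cast h)
  by_cases hle : R ≤ p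
  · have : (R : ℝ) ≤ p := by exact_mod_cast hle
    linarith
  · have ht : R ≤ p - 1 + Nat.clog 2 (p - 1) := by omega
    have hp1 : 1 < p - 1 := by
      by_contra h
      have : p - 1 = 1 := by omega
      rw [this] at ht
      simp at ht
      omega
    have h1 := Nat.pow_pred_clog_lt_self (b := 2) (by norm_num) hp1
    have h2 : 2 ^ (R - p) ≤ R := by
      calc 2 ^ (R - p) ≤ 2 ^ (Nat.clog 2 (p - 1)).pred :=
            Nat.pow_le_pow_right (by norm_num) (by rw [Nat.pred_eq_sub_one]; omega)
        _ ≤ R := by omega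
    have h3 : ((R - p : ℕ) : ℝ) ≤ Real.logb 2 R := by
      rw [Real.le_logb_iff_rpow_le (by norm_num) (by exact_mod_cast (by omega : 0 < R)),
        Real.rpow_natCast]
      exact_mod_cast h2
    rw [Nat.cast_sub (by omega)] at h3
    linarith

/-- **Theorem 2.** If `s` is the degree sequence of a tree `T` with no vertex of degree 2,
then `lp(T) ≥ rad(s) - log₂(rad(s))`. -/
theorem stmt_1 {V : Type*} [Fintype V] (G : SimpleGraph V) (hT : G.IsTree)
    (h2 : ∀ v, gdeg G v ≠ 2) (s : Multiset ℕ) (hs : s = degSeq G) :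
    (radSeq s : ℝ) - Real.logb 2 (radSeq s) ≤ ((lpSet G).ncard : ℝ) := by
  subst hs
  rcases Nat.lt_or_ge (Fintype.card V) 2 with hn | hn
  · have hsub : Subsingleton V := Fintype.card_le_one_iff_subsingleton.1 (by omega)
    obtain ⟨c⟩ := hT.connected.nonempty
    have h0 : radSeq (degSeq G) ≤ 0 :=
      radSeq_le G hT c 0 (fun w => by rw [Subsingleton.elim w c]; simp) _ rfl
    rw [Nat.le_zero.1 h0]
    simp
  · obtain ⟨h1, h3⟩ := rad_bound G hT h2 hn
    exact final_arith _ _ h1 h3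
end

section
/- For every degree sequence s = (d₁, d₂, …, dₙ) of a tree with ordered entries d₁ ≥ … ≥ dₙ, one has h(d₁, d₂ − 1, …, dₙ − 1) = rad(d₁, d₂, …, dₙ); that is, the minimum height of a rooted tree with out-degree sequence (d₁, d₂ − 1, …, dₙ − 1) equals the minimum radius of a tree with degree sequence (d₁, …, dₙ). -/
open SimpleGraph

/-- The graph of a parent function. -/
def pGraph {V : Type*} (p : V → V) (r : V) : SimpleGraph V :=
  SimpleGraph.fromRel (fun x y => x ≠ r ∧ p x = y)

lemma pGraph_adj {V : Type*} {p : V → V} {r : V} {g : V → ℕ}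
    (hg : ∀ x, x ≠ r → g x = g (p x) + 1) (x y : V) :
    (pGraph p r).Adj x y ↔ (x ≠ r ∧ p x = y) ∨ (y ≠ r ∧ p y = x) := by
  unfold pGraph
  rw [SimpleGraph.fromRel_adj]
  constructor
  · exact fun h => h.2
  · intro h
    refine ⟨?_, h⟩
    rintro rfl
    rcases h with ⟨h1, h2⟩ | ⟨h1, h2⟩ <;>
    · have := hg x h1
      rw [h2] at this
      omega

lemma pGraph_walk {V : Type*} {p : V → V} {r : V} {g : V → ℕ}
    (hr : g r = 0) (hg : ∀ x, x ≠ r → g x = g (p x) + 1) :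
    ∀ n x, g x = n → ∃ w : (pGraph p r).Walk x r, w.length = n := by
  intro n
  induction n with
  | zero =>
    intro x hx
    have : x = r := by
      by_contra h
      have := hg x h
      omega
    subst this
    exact ⟨SimpleGraph.Walk.nil, rfl⟩
  | succ n ih =>
    intro x hx
    have hxr : x ≠ r := by
      rintro rfl
      omega
    have := hg x hxr
    obtain ⟨w, hw⟩ := ih (p x) (by omega)
    exact ⟨SimpleGraph.Walk.cons ((pGraph_adj hg x (p x)).2 (Or.inl ⟨hxr, rfl⟩)) w, by simp [hw]⟩

lemma pGraph_connected {V : Type*} {p : V → V} {r : V} {g : V → ℕ}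
    (hr : g r = 0) (hg : ∀ x, x ≠ r → g x = g (p x) + 1) : (pGraph p r).Connected := by
  haveI : Nonempty V := ⟨r⟩
  refine SimpleGraph.Connected.mk ?_
  intro x y
  obtain ⟨w, -⟩ := pGraph_walk hr hg _ x rfl
  obtain ⟨w', -⟩ := pGraph_walk hr hg _ y rfl
  exact ⟨w.append w'.reverse⟩

lemma pGraph_le_length {V : Type*} {p : V → V} {r : V} {g : V → ℕ}
    (hg : ∀ x, x ≠ r → g x = g (p x) + 1) {x y : V} (w : (pGraph p r).Walk x y) :
    g y ≤ g x + w.length := by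
  induction w with
  | nil => simp
  | cons h w ih =>
    rw [pGraph_adj hg] at h
    rw [SimpleGraph.Walk.length_cons]
    rcases h with ⟨h1, h2⟩ | ⟨h1, h2⟩ <;>
    · have := hg _ h1
      rw [h2] at this
      omega

lemma pGraph_dist {V : Type*} {p : V → V} {r : V} {g : V → ℕ}
    (hr : g r = 0) (hg : ∀ x, x ≠ r → g x = g (p x) + 1) (x : V) :
    (pGraph p r).dist r x = g x := by
  apply le_antisymm
  · obtain ⟨w, hw⟩ := pGraph_walk hr hg _ x rfl
    rw [SimpleGraph.dist_comm]
    exact hw ▸ SimpleGraph.dist_le w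
  · obtain ⟨w, hw⟩ := (pGraph_connected hr hg).exists_walk_length_eq_dist r x
    have := pGraph_le_length hg w
    omega

lemma pGraph_isTree {V : Type*} [Fintype V] {p : V → V} {r : V} {g : V → ℕ}
    (hr : g r = 0) (hg : ∀ x, x ≠ r → g x = g (p x) + 1) : (pGraph p r).IsTree := by
  classical
  have hc := pGraph_connected hr hg
  rw [SimpleGraph.isTree_iff_connected_and_card]
  refine ⟨hc, le_antisymm ?_ hc.card_vert_le_card_edgeSet_add_one⟩
  have hsub : (pGraph p r).edgeSet ⊆
      (((Finset.univ.erase r).image (fun x => s(x, p x)) : Finset (Sym2 V)) : Set (Sym2 V)) := by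
    intro e he
    induction e using Sym2.ind with
    | _ a b =>
      rw [SimpleGraph.mem_edgeSet, pGraph_adj hg] at he
      simp only [Finset.coe_image, Set.mem_image, Finset.mem_coe, Finset.mem_erase,
        Finset.mem_univ, and_true]
      rcases he with ⟨h1, h2⟩ | ⟨h1, h2⟩
      · exact ⟨a, h1, by rw [h2]⟩
      · exact ⟨b, h1, by rw [h2, Sym2.eq_swap]⟩
  have h1 := Set.ncard_le_ncard hsub (Finset.finite_toSet _)
  rw [Set.ncard_coe_finset] at h1
  have h2 := Finset.card_image_le (s := Finset.univ.erase r) (f := fun x => s(x, p x))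
  rw [Finset.card_erase_of_mem (Finset.mem_univ r), Finset.card_univ] at h2
  have h3 : 0 < Fintype.card V := Fintype.card_pos_iff.2 ⟨r⟩
  rw [Nat.card_coe_set_eq, Nat.card_eq_fintype_card]
  omega

lemma pGraph_isChild {V : Type*} {p : V → V} {r : V} {g : V → ℕ}
    (hr : g r = 0) (hg : ∀ x, x ≠ r → g x = g (p x) + 1) (v u : V) :
    IsChild (pGraph p r) r v u ↔ u ≠ r ∧ p u = v := by
  unfold IsChild
  rw [pGraph_dist hr hg, pGraph_dist hr hg, pGraph_adj hg]
  constructor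
  · rintro ⟨⟨h1, h2⟩ | h, h3⟩
    · have := hg _ h1
      rw [h2] at this
      omega
    · exact h
  · intro h
    refine ⟨Or.inr h, ?_⟩
    rw [hg u h.1, h.2]

lemma tree_eq_pGraph {V : Type*} {G : SimpleGraph V} (hG : G.IsTree) (r : V) :
    ∃ p : V → V, (∀ x, x ≠ r → G.dist r x = G.dist r (p x) + 1) ∧ G = pGraph p r := by
  have hex : ∀ x, ∃ y, x ≠ r → G.Adj x y ∧ G.dist r x = G.dist r y + 1 := by
    intro x
    by_cases hx : x = r
    · exact ⟨x, fun h => absurd hx h⟩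
    obtain ⟨w, hw⟩ := hG.connected.exists_walk_length_eq_dist x r
    cases w with
    | nil => exact absurd rfl hx
    | cons h w =>
      rename_i y
      refine ⟨y, fun _ => ⟨h, ?_⟩⟩
      rw [SimpleGraph.Walk.length_cons] at hw
      have h1 := SimpleGraph.dist_le w
      have h2 := hG.connected.dist_triangle (u := x) (v := y) (w := r)
      rw [SimpleGraph.dist_eq_one_iff_adj.2 h] at h2
      rw [SimpleGraph.dist_comm, SimpleGraph.dist_comm (u := r)]
      omega
  choose p hp using hex
  have hg : ∀ x, x ≠ r → G.dist r x = G.dist r (p x) + 1 := fun x hx => (hp x hx).2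
  refine ⟨p, hg, ?_⟩
  have hle : pGraph p r ≤ G := by
    intro x y h
    rw [pGraph_adj hg] at h
    rcases h with ⟨h1, h2⟩ | ⟨h1, h2⟩
    · exact h2 ▸ (hp x h1).1
    · exact h2 ▸ (hp y h1).1.symm
  have hc : (pGraph p r).Connected := pGraph_connected (SimpleGraph.dist_self) hg
  exact le_antisymm ((SimpleGraph.isTree_iff_minimal_connected.1 hG).2 hc hle) hle

lemma exact_depth {V : Type*} {p : V → V} {r : V} {f : V → ℕ}
    (hf : ∀ x, x ≠ r → f (p x) < f x) :
    ∃ g : V → ℕ, g r = 0 ∧ (∀ x, x ≠ r → g x = g (p x) + 1) ∧ ∀ x, g x ≤ f x := by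
  classical
  have key : ∀ n x, f x ≤ n → ∃ m ≤ f x, p^[m] x = r := by
    intro n
    induction n with
    | zero =>
      intro x hx
      refine ⟨0, Nat.zero_le _, ?_⟩
      by_contra h
      have := hf x h
      omega
    | succ n ih =>
      intro x hx
      by_cases h : x = r
      · exact ⟨0, Nat.zero_le _, h⟩
      · have := hf x h
        obtain ⟨m, hm, hm'⟩ := ih (p x) (by omega)
        exact ⟨m + 1, by omega, by simpa using hm'⟩
  have key' : ∀ x, ∃ m, p^[m] x = r := fun x =>
    let ⟨m, _, h⟩ := key _ x le_rfl
    ⟨m, h⟩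
  refine ⟨fun x => Nat.find (key' x), ?_, ?_, ?_⟩
  · simp
  · intro x hx
    exact Nat.find_comp_succ (key' x) (key' (p x)) (by simpa using hx)
  · intro x
    obtain ⟨m, hm, h⟩ := key _ x le_rfl
    exact (Nat.find_min' (key' x) h).trans hm

lemma gdeg_root {V : Type*} {G : SimpleGraph V} (hG : G.IsTree) (r : V) :
    gdeg G r = outdeg G r r := by
  unfold gdeg outdeg IsChild
  congr 1
  ext u
  simp only [Set.mem_ofPred_eq, SimpleGraph.dist_self, zero_add, SimpleGraph.dist_eq_one_iff_adj,
    and_self]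

lemma gdeg_nonroot {V : Type*} [Finite V] {G : SimpleGraph V} (hG : G.IsTree) (r x : V)
    (hx : x ≠ r) : gdeg G x = outdeg G r x + 1 := by
  obtain ⟨p, hg, he⟩ := tree_eq_pGraph hG r
  have hr : G.dist r r = 0 := SimpleGraph.dist_self
  generalize G.dist r = g at hg hr
  subst he
  unfold gdeg outdeg
  have : {u | (pGraph p r).Adj x u} = insert (p x) {u | IsChild (pGraph p r) r x u} := by
    ext u
    simp only [Set.mem_ofPred_eq, Set.mem_insert_iff, pGraph_isChild hr hg, pGraph_adj hg]
    constructor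
    · rintro (h | h)
      · exact Or.inl h.2.symm
      · exact Or.inr h
    · rintro (h | h)
      · exact Or.inl ⟨hx, h.symm⟩
      · exact Or.inr h
  rw [this, Set.ncard_insert_of_notMem _ (Set.toFinite _)]
  simp only [Set.mem_ofPred_eq, pGraph_isChild hr hg]
  rintro ⟨h1, h2⟩
  have a := hg _ h1
  have b := hg _ hx
  rw [h2] at a
  omega

lemma surgery {V : Type*} [Fintype V] {G : SimpleGraph V} (hG : G.IsTree) (r v : V)
    (hv : v ≠ r) (k : ℕ) (hk : k ≤ outdeg G r v) :
    ∃ G' : SimpleGraph V, G'.IsTree ∧ outdeg G' r r = outdeg G r r + k ∧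
      outdeg G' r v + k = outdeg G r v ∧
      (∀ x, x ≠ r → x ≠ v → outdeg G' r x = outdeg G r x) ∧
      ∀ x, G'.dist r x ≤ G.dist r x := by
  classical
  obtain ⟨p, hg, he⟩ := tree_eq_pGraph hG r
  have hr : G.dist r r = 0 := SimpleGraph.dist_self
  have hgd : ∀ x, G.dist r x = G.dist r x := fun _ => rfl
  generalize hgen : G.dist r = g at hg hr
  subst he
  have hout : ∀ x, outdeg (pGraph p r) r x = {u | u ≠ r ∧ p u = x}.ncard := by
    intro x
    unfold outdeg
    simp only [pGraph_isChild hr hg]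
  obtain ⟨S, hS, hSk⟩ := Set.exists_subset_card_eq hk
  have hS' : ∀ u ∈ S, u ≠ r ∧ p u = v := fun u hu => (pGraph_isChild hr hg v u).1 (hS hu)
  let q : V → V := fun u => if u ∈ S then r else p u
  obtain ⟨g', hr', hg', hle⟩ := exact_depth (p := q) (r := r) (f := g) (by
    intro x hx
    have := hg x hx
    by_cases h : x ∈ S
    · simp only [q, if_pos h]
      omega
    · simp only [q, if_neg h]
      omega)
  have hout' : ∀ x, outdeg (pGraph q r) r x = {u | u ≠ r ∧ q u = x}.ncard := by
    intro x
    unfold outdeg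
    simp only [pGraph_isChild hr' hg']
  refine ⟨pGraph q r, pGraph_isTree hr' hg', ?_, ?_, ?_, ?_⟩
  · rw [hout, hout', ← hSk, ← Set.ncard_union_eq ?_ (Set.toFinite _) (Set.toFinite _)]
    · congr 1
      ext u
      simp only [Set.mem_ofPred_eq, Set.mem_union, q]
      by_cases h : u ∈ S
      · simp [h, (hS' u h).1]
      · simp [h]
    · rw [Set.disjoint_left]
      rintro u ⟨h1, h2⟩ h3
      exact hv ((hS' u h3).2.symm.trans h2)
  · rw [hout, hout', ← hSk, ← Set.ncard_union_eq ?_ (Set.toFinite _) (Set.toFinite _)]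
    · congr 1
      ext u
      simp only [Set.mem_ofPred_eq, Set.mem_union, q]
      by_cases h : u ∈ S
      · simp [h, hS' u h]
      · simp [h]
    · rw [Set.disjoint_left]
      rintro u ⟨h1, h2⟩ h3
      simp only [q, if_pos h3] at h2
      exact hv h2.symm
  · intro x hxr hxv
    rw [hout, hout']
    congr 1
    ext u
    simp only [Set.mem_ofPred_eq, q]
    by_cases h : u ∈ S
    · simp [h, hS' u h, hxr.symm, hxv.symm]
    · simp [h]
  · intro x
    rw [pGraph_dist hr' hg']
    exact hle x

lemma rheight_le {V : Type*} [Fintype V] {G G' : SimpleGraph V} {r : V}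
    (h : ∀ x, G'.dist r x ≤ G.dist r x) : rheight G' r ≤ rheight G r := by
  unfold rheight
  refine csSup_le (Exists.intro (G'.dist r r) ⟨r, rfl⟩) ?_
  rintro _ ⟨x, rfl⟩
  refine (h x).trans (le_csSup (Set.Finite.bddAbove (Set.finite_range (G.dist r))) ⟨x, rfl⟩)

lemma map_swap {V : Type*} [Fintype V] [DecidableEq V] (f f' : V → ℕ) (r v : V)
    (h1 : f' r = f v) (h2 : f' v = f r) (h3 : ∀ x, x ≠ r → x ≠ v → f' x = f x) :
    Multiset.map f' Finset.univ.val = Multiset.map f Finset.univ.val := by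
  have : f' = f ∘ Equiv.swap r v := by
    funext x
    by_cases hx : x = r
    · subst hx; simp [h1]
    by_cases hx' : x = v
    · subst hx'; simp [h2]
    · simp [Equiv.swap_apply_of_ne_of_ne hx hx', h3 x hx hx']
  rw [this]
  have h := Finset.map_univ_equiv (Equiv.swap r v)
  conv_rhs => rw [← h]
  simp only [Finset.map_val, Multiset.map_map]
  rfl

/-- Move the largest out-degree to the root. -/
lemma max_outdeg {V : Type*} [Fintype V] {G : SimpleGraph V} (hG : G.IsTree) (r v : V)
    (hv : outdeg G r r ≤ outdeg G r v) :
    ∃ G' : SimpleGraph V, G'.IsTree ∧ outDegSeq G' r = outDegSeq G r ∧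
      outdeg G' r r = outdeg G r v ∧ rheight G' r ≤ rheight G r := by
  classical
  by_cases h : v = r
  · subst h
    exact ⟨G, hG, rfl, rfl, le_rfl⟩
  obtain ⟨G', h1, h2, h3, h4, h5⟩ := surgery hG r v h (outdeg G r v - outdeg G r r) (by omega)
  exact ⟨G', h1, map_swap _ _ r v (by omega) (by omega) h4, by omega, rheight_le h5⟩

/-- Move the largest degree to the root. -/
lemma max_gdeg {V : Type*} [Fintype V] {G : SimpleGraph V} (hG : G.IsTree) (r v : V)
    (hv : gdeg G r ≤ gdeg G v) :
    ∃ G' : SimpleGraph V, G'.IsTree ∧ degSeq G' = degSeq G ∧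
      gdeg G' r = gdeg G v ∧ rheight G' r ≤ rheight G r := by
  classical
  by_cases h : v = r
  · subst h
    exact ⟨G, hG, rfl, rfl, le_rfl⟩
  have a := gdeg_root hG r
  have b := gdeg_nonroot hG r v h
  have hpos : 1 ≤ gdeg G r := by
    have := gdeg_nonroot hG v r (Ne.symm h)
    omega
  obtain ⟨G', h1, h2, h3, h4, h5⟩ := surgery hG r v h (gdeg G v - gdeg G r) (by omega)
  have a' := gdeg_root h1 r
  have b' := gdeg_nonroot h1 r v h
  refine ⟨G', h1, map_swap _ _ r v (by omega) (by omega) ?_, by omega, rheight_le h5⟩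
  intro x hx hx'
  rw [gdeg_nonroot h1 r x hx, gdeg_nonroot hG r x hx, h4 x hx hx']

lemma map_univ_split {V : Type*} [Fintype V] [DecidableEq V] (f : V → ℕ) (r : V) :
    Multiset.map f Finset.univ.val = f r ::ₘ Multiset.map f (Finset.univ.erase r).val := by
  conv_lhs => rw [← Finset.insert_erase (Finset.mem_univ r)]
  rw [Finset.insert_val_of_notMem (Finset.notMem_erase _ _), Multiset.map_cons]

lemma hSeq_eq (n : ℕ) (s : Multiset ℕ) (h : Multiset.card s = n) :
    hSeq s = sInf {h | ∃ (G : SimpleGraph (Fin n)) (r : Fin n),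
      G.IsTree ∧ outDegSeq G r = s ∧ rheight G r = h} := by
  subst h; rfl

lemma radSeq_eq (n : ℕ) (s : Multiset ℕ) (h : Multiset.card s = n) :
    radSeq s = sInf {e | ∃ G : SimpleGraph (Fin n),
      G.IsTree ∧ degSeq G = s ∧ treeRadius G = e} := by
  subst h; rfl

/-- For every degree sequence `s = (d₁, …, dₙ)` of a tree with `d₁ ≥ … ≥ dₙ`, the minimum
height of a rooted tree with out-degree sequence `(d₁, d₂ - 1, …, dₙ - 1)` equals the
minimum radius of a tree with degree sequence `(d₁, …, dₙ)`. -/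
theorem stmt_4 (n : ℕ) (hn : 1 ≤ n) (d : Fin n → ℕ)
    (hsorted : ∀ i j : Fin n, i ≤ j → d j ≤ d i)
    (htree : ∃ G : SimpleGraph (Fin n), G.IsTree ∧ degSeq G = Multiset.map d Finset.univ.val) :
    hSeq (Multiset.map (fun i : Fin n => if i = ⟨0, hn⟩ then d i else d i - 1) Finset.univ.val)
      = radSeq (Multiset.map d Finset.univ.val) := by
  classical
  set z : Fin n := ⟨0, hn⟩ with hz
  have hmax : ∀ i, d i ≤ d z := fun i => hsorted z i (Nat.zero_le _)
  rw [hSeq_eq n _ (by simp), radSeq_eq n _ (by simp)]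
  have hpos : ∀ i, i ≠ z → 1 ≤ d i := by
    intro i hi
    obtain ⟨G, hG, hd⟩ := htree
    have : d i ∈ degSeq G := by
      rw [hd]
      exact Multiset.mem_map_of_mem d (Finset.mem_univ i)
    obtain ⟨x, -, hx⟩ := Multiset.mem_map.1 this
    haveI : Nontrivial (Fin n) := ⟨⟨i, z, hi⟩⟩
    obtain ⟨y, hy⟩ := exists_ne x
    have := gdeg_nonroot hG y x hy.symm
    omega
  have hS1 : Multiset.map (fun i : Fin n => if i = z then d i else d i - 1) Finset.univ.val
      = d z ::ₘ Multiset.map (fun i => d i - 1) (Finset.univ.erase z).val := by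
    rw [map_univ_split _ z, if_pos rfl]
    congr 1
    apply Multiset.map_congr rfl
    intro x hx
    rw [if_neg (Finset.ne_of_mem_erase (Finset.mem_def.2 hx))]
  have hS2 := map_univ_split d z
  have hrest : Multiset.map (· + 1) (Multiset.map (fun i => d i - 1) (Finset.univ.erase z).val)
      = Multiset.map d (Finset.univ.erase z).val := by
    rw [Multiset.map_map]
    apply Multiset.map_congr rfl
    intro x hx
    have := hpos x (Finset.ne_of_mem_erase (Finset.mem_def.2 hx))
    simp only [Function.comp]
    omega
  have hrest' : Multiset.map (fun i => d i - 1) (Finset.univ.erase z).val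
      = Multiset.map (· - 1) (Multiset.map d (Finset.univ.erase z).val) := by
    rw [Multiset.map_map]
    rfl
  have d2 : ∀ e ∈ {e | ∃ G : SimpleGraph (Fin n), G.IsTree ∧
      degSeq G = Multiset.map d Finset.univ.val ∧ treeRadius G = e},
      ∃ h ∈ {h | ∃ (G : SimpleGraph (Fin n)) (r : Fin n), G.IsTree ∧ outDegSeq G r =
        Multiset.map (fun i : Fin n => if i = z then d i else d i - 1) Finset.univ.val ∧
        rheight G r = h}, h ≤ e := by
    rintro e ⟨G, hG, hd, rfl⟩
    obtain ⟨c, hc⟩ : treeRadius G ∈ {e | ∃ v, ecc G v = e} := Nat.sInf_mem ⟨_, z, rfl⟩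
    obtain ⟨v, -, hv⟩ : ∃ v ∈ Finset.univ.val, gdeg G v = d z := by
      rw [← Multiset.mem_map]
      change _ ∈ degSeq G
      rw [hd]
      exact Multiset.mem_map_of_mem d (Finset.mem_univ z)
    have hcv : gdeg G c ≤ gdeg G v := by
      have : gdeg G c ∈ degSeq G := Multiset.mem_map_of_mem _ (Finset.mem_univ c)
      rw [hd] at this
      obtain ⟨i, -, hi⟩ := Multiset.mem_map.1 this
      rw [hv, ← hi]
      exact hmax i
    obtain ⟨G', h1, h2, h3, h4⟩ := max_gdeg hG c v hcv
    refine ⟨_, ⟨G', c, h1, ?_, rfl⟩, h4.trans hc.le⟩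
    rw [hd, hS2] at h2
    unfold degSeq at h2
    rw [map_univ_split _ c, h3, hv, Multiset.cons_inj_right] at h2
    rw [hS1, hrest', ← h2, Multiset.map_map]
    unfold outDegSeq
    rw [map_univ_split _ c, ← gdeg_root h1, h3, hv]
    congr 1
    apply Multiset.map_congr rfl
    intro x hx
    simp only [Function.comp]
    rw [gdeg_nonroot h1 c x (Finset.ne_of_mem_erase (Finset.mem_def.2 hx)), Nat.add_sub_cancel]
  have d1 : ∀ h ∈ {h | ∃ (G : SimpleGraph (Fin n)) (r : Fin n), G.IsTree ∧ outDegSeq G r =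
        Multiset.map (fun i : Fin n => if i = z then d i else d i - 1) Finset.univ.val ∧
        rheight G r = h}, ∃ e ∈ {e | ∃ G : SimpleGraph (Fin n), G.IsTree ∧
      degSeq G = Multiset.map d Finset.univ.val ∧ treeRadius G = e}, e ≤ h := by
    rintro h ⟨G, r, hG, hd, rfl⟩
    obtain ⟨v, -, hv⟩ : ∃ v ∈ Finset.univ.val, outdeg G r v = d z := by
      rw [← Multiset.mem_map]
      change _ ∈ outDegSeq G r
      rw [hd, hS1]
      exact Multiset.mem_cons_self _ _
    have hcv : outdeg G r r ≤ outdeg G r v := by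
      have : outdeg G r r ∈ outDegSeq G r := Multiset.mem_map_of_mem _ (Finset.mem_univ r)
      rw [hd] at this
      obtain ⟨i, -, hi⟩ := Multiset.mem_map.1 this
      rw [hv, ← hi]
      have := hmax i
      split_ifs <;> omega
    obtain ⟨G', h1, h2, h3, h4⟩ := max_outdeg hG r v hcv
    refine ⟨_, ⟨G', h1, ?_, rfl⟩, (Nat.sInf_le ⟨r, rfl⟩ : treeRadius G' ≤ ecc G' r).trans h4⟩
    rw [hd, hS1] at h2
    unfold outDegSeq at h2
    rw [map_univ_split _ r, h3, hv, Multiset.cons_inj_right] at h2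
    rw [hS2, ← hrest, ← h2, Multiset.map_map]
    unfold degSeq
    rw [map_univ_split _ r, gdeg_root h1, h3, hv]
    congr 1
    apply Multiset.map_congr rfl
    intro x hx
    exact gdeg_nonroot h1 r x (Finset.ne_of_mem_erase (Finset.mem_def.2 hx))
  have ne2 : {e | ∃ G : SimpleGraph (Fin n), G.IsTree ∧
      degSeq G = Multiset.map d Finset.univ.val ∧ treeRadius G = e}.Nonempty := by
    obtain ⟨G, hG, hd⟩ := htree
    exact ⟨_, G, hG, hd, rfl⟩
  have ne1 : {h | ∃ (G : SimpleGraph (Fin n)) (r : Fin n), G.IsTree ∧ outDegSeq G r =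
        Multiset.map (fun i : Fin n => if i = z then d i else d i - 1) Finset.univ.val ∧
        rheight G r = h}.Nonempty := by
    obtain ⟨e, he⟩ := ne2
    obtain ⟨h, hh, -⟩ := d2 e he
    exact ⟨h, hh⟩
  apply le_antisymm
  · obtain ⟨h, hh, hle⟩ := d2 _ (Nat.sInf_mem ne2)
    exact (Nat.sInf_le hh).trans hle
  · obtain ⟨h, hh, hle⟩ := d1 _ (Nat.sInf_mem ne1)
    exact (Nat.sInf_le hh).trans hle
end

section
/- If (T, r) is a rooted tree that has leaves of k different depths, then lp(T, r) ≥ k, where lp(T, r) = lp(T) is the number of different lengths of leaf to leaf paths in the underlying undirected tree T. -/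
open SimpleGraph

/-- Distances across an edge `xw` of a tree add up. -/
lemma dist_cross {V : Type*} (G : SimpleGraph V) (hT : G.IsTree) {w x a b : V} (hwx : G.Adj w x)
    (ha : G.dist w a = G.dist x a + 1) (hb : G.dist x b = G.dist w b + 1) :
    G.dist a b = G.dist w a + G.dist w b := by
  classical
  obtain ⟨p, hp, hpl⟩ := hT.connected.exists_path_of_dist a x
  obtain ⟨q, hq, hql⟩ := hT.connected.exists_path_of_dist w b
  have hpath : (p.append (Walk.cons hwx.symm q)).IsPath := by
    rw [Walk.isPath_def, Walk.support_append, Walk.support_cons, List.tail_cons,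
      List.nodup_append]
    refine ⟨hp.support_nodup, hq.support_nodup, ?_⟩
    rintro y hy z hz rfl
    have h1 : (p.takeUntil y hy).length + (p.dropUntil y hy).length = p.length := by
      rw [← Walk.length_append, Walk.take_spec]
    have h2 : (q.takeUntil y hz).length + (q.dropUntil y hz).length = q.length := by
      rw [← Walk.length_append, Walk.take_spec]
    have e1 := dist_le (p.takeUntil y hy)
    have e2 := dist_le (p.dropUntil y hy)
    have e3 := dist_le (q.takeUntil y hz)
    have e4 := dist_le (q.dropUntil y hz)
    have t1 := hT.connected.dist_triangle (u := w) (v := y) (w := a)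
    have t2 := hT.connected.dist_triangle (u := x) (v := y) (w := b)
    have c1 := G.dist_comm (u := a) (v := y)
    have c2 := G.dist_comm (u := x) (v := y)
    have c3 := G.dist_comm (u := a) (v := x)
    omega
  obtain ⟨s, hs, hsl⟩ := hT.connected.exists_path_of_dist a b
  have := (hT.existsUnique_path a b).unique hs hpath
  have c3 := G.dist_comm (u := a) (v := x)
  rw [← hsl, this, Walk.length_append, Walk.length_cons]
  omega

/-- A leaf of the rooted tree is a leaf of the tree. -/
lemma IsRLeaf.isLeafV {V : Type*} [Fintype V] {G : SimpleGraph V} (hT : G.IsTree) {r v : V}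
    (h : IsRLeaf G r v) : IsLeafV G v := by
  unfold IsLeafV gdeg
  rw [Set.ncard_le_one (Set.toFinite _)]
  intro y hy y' hy'
  simp only [Set.mem_ofPred_eq] at hy hy'
  by_contra hne
  have k1 := hT.dist_eq_dist_add_one_of_adj r hy
  have k2 := hT.dist_eq_dist_add_one_of_adj r hy'
  have n1 : ¬ G.dist r y = G.dist r v + 1 := fun e => h y ⟨hy, e⟩
  have n2 : ¬ G.dist r y' = G.dist r v + 1 := fun e => h y' ⟨hy', e⟩
  have d1 : G.dist v y' = 1 := dist_eq_one_iff_adj.2 hy'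
  have k3 := hT.dist_eq_dist_add_one_of_adj y' hy
  have k4 := hT.connected.pos_dist_of_ne hne
  have c1 := G.dist_comm (u := y') (v := v)
  have c2 := G.dist_comm (u := y') (v := y)
  have c3 := G.dist_comm (u := v) (v := r)
  have c4 := G.dist_comm (u := y) (v := r)
  have := dist_cross G hT hy (a := r) (b := y') (by omega) (by omega)
  omega

/-- Leaves at pairwise distinct depths give many leaf-to-leaf distances. -/
lemma card_le_lpSet {V : Type*} [Fintype V] (G : SimpleGraph V) (r : V) (hT : G.IsTree)
    (S : Finset V) (hS : ∀ s ∈ S, IsLeafV G s)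
    (hinj : ∀ s ∈ S, ∀ t ∈ S, G.dist r s = G.dist r t → s = t) :
    S.card ≤ (lpSet G).ncard := by
  classical
  have hfin : (lpSet G).Finite := by
    refine (Set.finite_range (fun z : V × V => G.dist z.1 z.2)).subset ?_
    rintro n ⟨u, v, -, -, rfl⟩
    exact ⟨(u, v), rfl⟩
  rcases S.eq_empty_or_nonempty with rfl | ⟨s1, hs1⟩
  · simp
  have h0 : 0 ∈ lpSet G := ⟨s1, s1, hS _ hs1, hS _ hs1, dist_self⟩
  by_cases hcard : S.card ≤ 1
  · exact hcard.trans ((Set.ncard_pos hfin).2 ⟨0, h0⟩)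
  push Not at hcard
  obtain ⟨w, hw, hmax⟩ : ∃ w, (∀ s ∈ S, G.dist r w + G.dist w s = G.dist r s) ∧
      ∀ x, (∀ s ∈ S, G.dist r x + G.dist x s = G.dist r s) → G.dist r x ≤ G.dist r w :=
    Set.exists_max_image {w | ∀ s ∈ S, G.dist r w + G.dist w s = G.dist r s}
      (fun w => G.dist r w) (Set.toFinite _) ⟨r, fun s _ => by simp⟩
  have hinj' : ∀ s ∈ S, ∀ t ∈ S, G.dist w s = G.dist w t → s = t := fun s hs t ht e =>
    hinj s hs t ht (by have := hw s hs; have := hw t ht; omega)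
  obtain ⟨s0, hs0, hne⟩ := Finset.exists_mem_ne hcard w
  obtain ⟨p, hp⟩ := hT.connected.exists_walk_length_eq_dist w s0
  obtain ⟨x, hwx, hx⟩ : ∃ x, G.Adj w x ∧ G.dist w s0 = G.dist x s0 + 1 := by
    cases p with
    | nil => exact absurd rfl hne
    | @cons _ x _ h q =>
      refine ⟨x, h, ?_⟩
      have := dist_le q
      rw [Walk.length_cons] at hp
      have t := hT.connected.dist_triangle (u := w) (v := x) (w := s0)
      have := dist_eq_one_iff_adj.2 h
      omega
  set A := S.filter (fun s => G.dist w s = G.dist x s + 1) with hA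
  set B := S.filter (fun s => ¬ G.dist w s = G.dist x s + 1) with hB
  have hAB : A.card + B.card = S.card := Finset.card_filter_add_card_filter_not _
  have hAne : A.Nonempty := ⟨s0, by simp [hA, hs0, hx]⟩
  have hBne : B.Nonempty := by
    by_contra hBe
    rw [Finset.not_nonempty_iff_eq_empty, hB, Finset.filter_eq_empty_iff] at hBe
    have d1 := dist_eq_one_iff_adj.2 hwx
    have t1 := hT.connected.dist_triangle (u := r) (v := w) (w := x)
    have key : ∀ s ∈ S, G.dist r x = G.dist r w + 1 ∧ G.dist r x + G.dist x s = G.dist r s := by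
      intro s hs
      have h1 := hw s hs
      have h2 := not_not.1 (hBe hs)
      have t2 := hT.connected.dist_triangle (u := r) (v := x) (w := s)
      omega
    have := hmax x (fun s hs => (key s hs).2)
    have := (key s0 hs0).1
    omega
  have cA : (A.image (G.dist w)).card = A.card := Finset.card_image_of_injOn
    (fun s hs t ht e => hinj' s (Finset.mem_filter.1 hs).1 t (Finset.mem_filter.1 ht).1 e)
  have cB : (B.image (G.dist w)).card = B.card := Finset.card_image_of_injOn
    (fun s hs t ht e => hinj' s (Finset.mem_filter.1 hs).1 t (Finset.mem_filter.1 ht).1 e)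
  have cd := cauchy_davenport_add_of_linearOrder_isCancelAdd
    (hAne.image (G.dist w)) (hBne.image (G.dist w))
  have hsub : ((insert 0 (Finset.image (fun z : ℕ × ℕ => z.1 + z.2)
      (A.image (G.dist w) ×ˢ B.image (G.dist w))) : Finset ℕ) : Set ℕ) ⊆ lpSet G := by
    intro n hn
    simp only [Finset.coe_insert, Set.mem_insert_iff, Finset.mem_coe, Finset.mem_image,
      Finset.mem_product, Prod.exists] at hn
    rcases hn with rfl | ⟨_, _, ⟨⟨a, ha, rfl⟩, ⟨b, hb, rfl⟩⟩, rfl⟩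
    · exact h0
    · have ha' := Finset.mem_filter.1 ha
      have hb' := Finset.mem_filter.1 hb
      refine ⟨a, b, hS a ha'.1, hS b hb'.1, dist_cross G hT hwx ha'.2 ?_⟩
      have := hT.dist_eq_dist_add_one_of_adj b hwx
      have c1 := G.dist_comm (u := b) (v := w)
      have c2 := G.dist_comm (u := b) (v := x)
      have := hb'.2
      omega
  have hle := Set.ncard_le_ncard hsub hfin
  rw [Set.ncard_coe_finset, Finset.card_insert_of_notMem] at hle
  · have e : Finset.image (fun z : ℕ × ℕ => z.1 + z.2)
      (A.image (G.dist w) ×ˢ B.image (G.dist w)) =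
        (open Pointwise in A.image (G.dist w) + B.image (G.dist w)) := rfl
    rw [e] at hle
    omega
  · simp only [Finset.mem_image, Finset.mem_product, Prod.exists, not_exists]
    rintro _ _ ⟨⟨⟨a, ha, rfl⟩, _⟩, h⟩
    have := (Finset.mem_filter.1 ha).2
    omega

/-- **Lemma 1.** If a rooted tree `(T, r)` has leaves of `k` different depths, then
`lp(T, r) ≥ k`, where `lp(T, r) = lp(T)` for the underlying undirected tree. -/
theorem stmt_5 {V : Type*} [Fintype V] (G : SimpleGraph V) (r : V) (hT : G.IsTree)
    (k : ℕ) (hk : {d : ℕ | ∃ v, IsRLeaf G r v ∧ G.dist r v = d}.ncard = k) :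
    k ≤ (lpSet G).ncard := by
  classical
  subst hk
  set D := {d : ℕ | ∃ v, IsRLeaf G r v ∧ G.dist r v = d} with hD
  have hDf : D.Finite := by
    refine (Set.finite_range (fun v : V => G.dist r v)).subset ?_
    rintro n ⟨v, -, rfl⟩
    exact ⟨v, rfl⟩
  have hex : ∀ d ∈ D, ∃ v, IsRLeaf G r v ∧ G.dist r v = d := fun d hd => hd
  haveI : Nonempty V := ⟨r⟩
  choose! f hf1 hf2 using hex
  have hmem : ∀ s ∈ hDf.toFinset.image f, ∃ d ∈ D, f d = s := by
    intro s hs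
    simpa using hs
  have key := card_le_lpSet G r hT (hDf.toFinset.image f)
    (fun s hs => by
      obtain ⟨d, hd, rfl⟩ := hmem s hs
      exact (hf1 d hd).isLeafV hT)
    (fun s hs t ht e => by
      obtain ⟨d, hd, rfl⟩ := hmem s hs
      obtain ⟨d', hd', rfl⟩ := hmem t ht
      rw [hf2 d hd, hf2 d' hd'] at e
      rw [e])
  rw [Finset.card_image_of_injOn, ← Set.ncard_eq_toFinset_card D hDf] at key
  · exact key
  · intro d hd d' hd' e
    simp only [Set.Finite.coe_toFinset] at hd hd'
    rw [← hf2 d hd, ← hf2 d' hd', e]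
end

section
/- If (T, r) is a rooted tree with out-degree sequence s⁺ and U = {u₁, …, u_k} is a set of k leaves of (T, r) that all have equal depth, then there are leaf to leaf paths between vertices in U of at least h(s⁺, k) + 1 different lengths; in particular, lp(T, r) ≥ h(s⁺, k) + 1. -/
open SimpleGraph

/-- A rooted tree given by a parent function and a level function. -/
structure PT (W : Type*) where
  root : W
  p : W → Option W
  lev : W → ℕ
  proot : p root = none
  pnone : ∀ u, p u = none → u = root
  lroot : lev root = 0
  hlev : ∀ u w, p u = some w → lev u = lev w + 1

namespace PT

noncomputable def od {W : Type*} (P : PT W) (w : W) : ℕ := {u | P.p u = some w}.ncard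

def graph {W : Type*} (P : PT W) : SimpleGraph W where
  Adj u v := P.p u = some v ∨ P.p v = some u
  symm := ⟨fun _ _ h => h.symm⟩
  loopless := ⟨fun u h => by
    have h' : P.p u = some u := by tauto
    have := P.hlev u u h'
    omega⟩

theorem exists_walk {W : Type*} (P : PT W) (n : ℕ) (w : W) (hn : P.lev w = n) :
    ∃ q : P.graph.Walk P.root w, q.length = n := by
  induction n generalizing w with
  | zero =>
    have : w = P.root := by
      cases h : P.p w with
      | none => exact P.pnone w h
      | some x => have := P.hlev _ _ h; omega
    subst this
    exact ⟨Walk.nil, rfl⟩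
  | succ n ih =>
    cases h : P.p w with
    | none => 
      have := P.pnone w h
      rw [this, P.lroot] at hn
      omega
    | some x =>
      have := P.hlev _ _ h
      obtain ⟨q, hq⟩ := ih x (by omega)
      have ha : P.graph.Adj x w := Or.inr h
      exact ⟨q.concat ha, by simp [hq]⟩

theorem lev_le {W : Type*} (P : PT W) (u v : W) (q : P.graph.Walk u v) :
    P.lev v ≤ P.lev u + q.length := by
  induction q with
  | nil => simp
  | cons h q ih =>
    rw [Walk.length_cons]
    rcases h with h | h <;> have := P.hlev _ _ h <;> omega

theorem connected {W : Type*} (P : PT W) : P.graph.Connected := by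
  have h : ∀ w, P.graph.Reachable P.root w := fun w => by
    obtain ⟨q, -⟩ := P.exists_walk _ w rfl
    exact ⟨q⟩
  have : Nonempty W := ⟨P.root⟩
  exact ⟨fun u v => (h u).symm.trans (h v)⟩

theorem dist_eq {W : Type*} (P : PT W) (w : W) : P.graph.dist P.root w = P.lev w := by
  apply le_antisymm
  · obtain ⟨q, hq⟩ := P.exists_walk _ w rfl
    rw [← hq]
    exact dist_le q
  · obtain ⟨q, hq⟩ := P.connected.exists_walk_length_eq_dist P.root w
    have := P.lev_le _ _ q
    rw [P.lroot] at this
    omega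

theorem isChild_iff {W : Type*} (P : PT W) (v u : W) :
    IsChild P.graph P.root v u ↔ P.p u = some v := by
  unfold IsChild
  rw [P.dist_eq, P.dist_eq]
  constructor
  · rintro ⟨h | h, h2⟩
    · have := P.hlev _ _ h
      omega
    · exact h
  · intro h
    exact ⟨Or.inr h, P.hlev _ _ h⟩

theorem outdeg_eq {W : Type*} (P : PT W) (v : W) : outdeg P.graph P.root v = P.od v := by
  unfold outdeg od
  simp only [P.isChild_iff]

theorem isTree {W : Type*} [Finite W] (P : PT W) : P.graph.IsTree := by
  classical
  rw [isTree_iff_connected_and_card]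
  refine ⟨P.connected, le_antisymm ?_ P.connected.card_vert_le_card_edgeSet_add_one⟩
  have hs : P.graph.edgeSet ⊆ (fun u => s(u, (P.p u).getD u)) '' {u | u ≠ P.root} := by
    intro e
    induction e using Sym2.ind with
    | _ x y =>
      intro h
      have key : ∀ a b, P.p a = some b → a ≠ P.root := by
        rintro a b h rfl
        rw [P.proot] at h
        cases h
      rcases h with h | h
      · exact ⟨x, key _ _ h, by simp [h]⟩
      · exact ⟨y, key _ _ h, by simp [h, Sym2.eq_swap]⟩
  have h1 : P.graph.edgeSet.ncard ≤ {u | u ≠ P.root}.ncard :=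
    (Set.ncard_le_ncard hs (Set.toFinite _)).trans (Set.ncard_image_le (Set.toFinite _))
  have h2 := Set.ncard_add_ncard_compl ({P.root} : Set W)
  rw [Set.ncard_singleton] at h2
  have h3 : {u | u ≠ P.root} = ({P.root} : Set W)ᶜ := by ext; simp
  rw [h3] at h1
  rw [Nat.card_coe_set_eq]
  omega

theorem isRLeaf {W : Type*} [Finite W] (P : PT W) (v : W) (h : P.od v = 0) :
    IsRLeaf P.graph P.root v := by
  intro u hu
  rw [P.isChild_iff] at hu
  unfold od at h
  rw [Set.ncard_eq_zero (Set.toFinite _)] at h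
  have : u ∈ ({u | P.p u = some v} : Set W) := hu
  rw [h] at this
  exact this

theorem sum_od {W : Type*} [Fintype W] (P : PT W) (A : Finset W) :
    ∑ a ∈ A, P.od a = {u | ∃ a ∈ A, P.p u = some a}.ncard := by
  classical
  induction A using Finset.induction_on with
  | empty => simp
  | insert a A ha ih =>
    rw [Finset.sum_insert ha, ih]
    unfold od
    rw [← Set.ncard_union_eq _ (Set.toFinite _) (Set.toFinite _)]
    · congr 1
      ext u
      simp
    · rw [Set.disjoint_left]
      rintro u h ⟨b, hb, h'⟩
      simp only [Set.mem_ofPred_eq] at h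
      rw [h] at h'
      cases h'
      exact ha hb

theorem sum_univ {W : Type*} [Fintype W] (P : PT W) :
    1 + ∑ a, P.od a = Fintype.card W := by
  rw [P.sum_od]
  have h2 := Set.ncard_add_ncard_compl ({P.root} : Set W)
  rw [Set.ncard_singleton] at h2
  rw [← Nat.card_eq_fintype_card, ← h2]
  congr 2
  ext u
  simp only [Finset.mem_univ, true_and, Set.mem_ofPred_eq, Set.mem_compl_iff, Set.mem_singleton_iff]
  constructor
  · rintro ⟨a, h⟩ rfl
    rw [P.proot] at h
    cases h
  · intro h
    cases h' : P.p u with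
    | none => exact absurd (P.pnone _ h') h
    | some x => exact ⟨x, rfl⟩

/-- Transport along an equivalence. -/
def transport {W W' : Type*} (P : PT W) (e : W ≃ W') : PT W' where
  root := e P.root
  p u := (P.p (e.symm u)).map e
  lev u := P.lev (e.symm u)
  proot := by simp [P.proot]
  pnone u h := by
    rw [Option.map_eq_none_iff] at h
    rw [← P.pnone _ h]; simp
  lroot := by simp [P.lroot]
  hlev u w h := by
    rw [Option.map_eq_some_iff] at h
    obtain ⟨a, h, rfl⟩ := h
    simpa using P.hlev _ _ h

theorem transport_od {W W' : Type*} (P : PT W) (e : W ≃ W') (w : W) :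
    (P.transport e).od (e w) = P.od w := by
  unfold od
  rw [← Set.ncard_image_of_injective _ e.injective]
  congr 1
  ext u
  simp [transport]

/-- A parent structure yields a feasible height. -/
theorem feas {W : Type*} [Fintype W] (P : PT W) (t k : ℕ) (s : Multiset ℕ)
    (ht : ∀ w, P.lev w ≤ t) (hs : Finset.univ.val.map P.od ≤ s)
    (hk : k ≤ {w | P.od w = 0}.ncard) : hSeqK s k ≤ t := by
  classical
  let e := Fintype.equivFin W
  let Q := P.transport e
  have hmem : rheight Q.graph Q.root ∈ hFeas s k := by
    refine ⟨_, Q.graph, Q.root, Q.isTree, ?_, ?_, rfl⟩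
    · unfold outDegSeq
      have : outdeg Q.graph Q.root = Q.od := funext Q.outdeg_eq
      rw [this]
      refine le_trans (le_of_eq ?_) hs
      have h2 : (Finset.univ : Finset (Fin (Fintype.card W))) = Finset.univ.map e.toEmbedding := by
        simp
      rw [h2, Finset.map_val, Multiset.map_map]
      exact Multiset.map_congr rfl fun w _ => P.transport_od e w
    · refine hk.trans ?_
      rw [← Set.ncard_image_of_injective _ e.injective]
      apply Set.ncard_le_ncard _ (Set.toFinite _)
      rintro _ ⟨w, hw, rfl⟩
      apply Q.isRLeaf
      exact (P.transport_od e w).trans hw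
  refine (Nat.sInf_le hmem).trans ?_
  unfold rheight
  refine csSup_le (Set.nonempty_of_mem (x := Q.graph.dist Q.root Q.root) ⟨Q.root, rfl⟩) ?_
  rintro d ⟨v, rfl⟩
  rw [Q.dist_eq]
  exact ht _

end PT

/-- A tree rooted at `r` yields a parent structure. -/
theorem exists_PT {V : Type*} (G : SimpleGraph V) (r : V) (hT : G.IsTree) :
    ∃ P : PT V, P.root = r ∧ (∀ u v, P.p u = some v ↔ IsChild G r v u) ∧
      ∀ v, P.lev v = G.dist r v := by
  classical
  have hex : ∀ u, u ≠ r → ∃ v, IsChild G r v u := by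
    intro u hu
    obtain ⟨q, hq⟩ := hT.connected.exists_walk_length_eq_dist u r
    cases q with
    | nil => exact absurd rfl hu
    | cons h q =>
      refine ⟨_, h.symm, ?_⟩
      have h1 := dist_le q
      rw [Walk.length_cons] at hq
      have h2 := hT.dist_eq_dist_add_one_of_adj r h
      rw [dist_comm] at h1 hq
      omega
  have huniq : ∀ u v w, IsChild G r v u → IsChild G r w u → v = w := by
    intro u v w hv hw
    obtain ⟨q1, h1⟩ := hT.connected.exists_walk_length_eq_dist r v
    obtain ⟨q2, h2⟩ := hT.connected.exists_walk_length_eq_dist r w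
    have hp1 : (q1.concat hv.1).IsPath := Walk.isPath_of_length_eq_dist _ (by
      rw [Walk.length_concat, h1, hv.2])
    have hp2 : (q2.concat hw.1).IsPath := Walk.isPath_of_length_eq_dist _ (by
      rw [Walk.length_concat, h2, hw.2])
    have := (hT.existsUnique_path r u).unique hp1 hp2
    have := congrArg Walk.penultimate this
    simpa using this
  refine ⟨⟨r, fun u => if h : ∃ v, IsChild G r v u then some h.choose else none, G.dist r,
    ?_, ?_, ?_, ?_⟩, rfl, ?_, fun _ => rfl⟩
  · rw [dif_neg]
    rintro ⟨v, h⟩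
    have := h.2
    simp at this
  · intro u h
    by_contra hu
    rw [dif_pos (hex u hu)] at h
    cases h
  · simp
  · intro u w h
    split_ifs at h with h'
    cases h
    exact h'.choose_spec.2
  · intro u v
    constructor
    · intro h
      simp only at h
      split_ifs at h with h'
      cases h
      exact h'.choose_spec
    · intro h
      have h' : ∃ v, IsChild G r v u := ⟨v, h⟩
      simp only
      rw [dif_pos h']
      exact congrArg some (huniq _ _ _ h'.choose_spec h)

namespace PT

/-- Attach below the (leaf) vertices `e a`, `a ∈ A`, the children of `a` in `Q`. -/
def grow {W V : Type*} (P : PT W) (Q : PT V) (A : Finset V) (e : V → W) :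
    PT (W ⊕ {u : V // ∃ a ∈ A, Q.p u = some a}) where
  root := Sum.inl P.root
  p := Sum.elim (fun w => (P.p w).map Sum.inl) (fun u => (Q.p u).map (fun a => Sum.inl (e a)))
  lev := Sum.elim P.lev (fun u => ((Q.p u).map (fun a => P.lev (e a) + 1)).getD 0)
  proot := by simp [P.proot]
  pnone u h := by
    rcases u with w | ⟨u, a, ha, hu⟩
    · simp at h
      rw [P.pnone _ h]
    · simp [hu] at h
  lroot := by simp [P.lroot]
  hlev u x h := by
    rcases u with w | ⟨u, a, ha, hu⟩
    · simp only [Sum.elim_inl, Option.map_eq_some_iff] at h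
      obtain ⟨y, hy, rfl⟩ := h
      simpa using P.hlev _ _ hy
    · simp only [Sum.elim_inr, hu, Option.map_some, Option.some.injEq] at h
      subst h
      simp [hu]

theorem grow_od_inr {W V : Type*} (P : PT W) (Q : PT V) (A : Finset V) (e : V → W)
    (x : {u : V // ∃ a ∈ A, Q.p u = some a}) : (P.grow Q A e).od (Sum.inr x) = 0 := by
  unfold od
  have : {u | (P.grow Q A e).p u = some (Sum.inr x)} = ∅ := by
    ext u
    simp only [Set.mem_ofPred_eq, Set.mem_empty_iff_false, iff_false]
    rcases u with w | ⟨u, a, ha, hu⟩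
    · simp [grow]
    · simp [grow]
  rw [this, Set.ncard_empty]

theorem grow_od_not_mem {W V : Type*} (P : PT W) (Q : PT V) (A : Finset V) (e : V → W)
    (w : W) (hw : ∀ a ∈ A, e a ≠ w) : (P.grow Q A e).od (Sum.inl w) = P.od w := by
  unfold od
  rw [← Set.ncard_image_of_injective {u | P.p u = some w}
    (Sum.inl_injective (β := {u : V // ∃ a ∈ A, Q.p u = some a}))]
  congr 1
  ext u
  simp only [Set.mem_ofPred_eq, Set.mem_image]
  rcases u with x | ⟨u, a, ha, hu⟩
  · simp [grow]
  · simp [grow, hu, hw a ha]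

theorem grow_od_mem {W V : Type*} [Finite W] (P : PT W) (Q : PT V) (A : Finset V) (e : V → W)
    (he : Set.InjOn e A) (a : V) (ha : a ∈ A) (h0 : P.od (e a) = 0) :
    (P.grow Q A e).od (Sum.inl (e a)) = Q.od a := by
  unfold od at *
  rw [Set.ncard_eq_zero (Set.toFinite _)] at h0
  rw [← Set.ncard_image_of_injective {u | (P.grow Q A e).p u = some (Sum.inl (e a))}
    (Function.Injective.comp (Option.some_injective _) Function.injective_id)]
  symm
  apply Set.ncard_congr (fun u (hu : u ∈ {u | Q.p u = some a}) =>
    some (Sum.inr (α := W) ⟨u, a, ha, hu⟩))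
  · intro u hu
    refine ⟨_, ?_, rfl⟩
    simp only [Set.mem_ofPred_eq] at hu
    simp [grow, hu]
  · intro u v hu hv h
    simpa using h
  · rintro _ ⟨u, hu, rfl⟩
    rcases u with x | ⟨u, b, hb, hu'⟩
    · simp only [grow, Set.mem_ofPred_eq, Sum.elim_inl, Option.map_eq_some_iff] at hu
      obtain ⟨y, hy, hy'⟩ := hu
      cases hy'
      have : x ∈ ({u | P.p u = some (e a)} : Set W) := hy
      rw [h0] at this
      exact this.elim
    · simp only [grow, Set.mem_ofPred_eq, Sum.elim_inr, hu', Option.map_some,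
        Option.some.injEq, Sum.inl.injEq] at hu
      have := he hb ha hu
      subst this
      exact ⟨u, hu', rfl⟩

open Classical in
theorem grow_seq {W V : Type*} [Fintype W] [Fintype V] (P : PT W) (Q : PT V) (A : Finset V)
    (e : V → W) (he : Set.InjOn e A) (h0 : ∀ a ∈ A, P.od (e a) = 0) :
    Finset.univ.val.map (P.grow Q A e).od + Multiset.replicate A.card 0 =
      Finset.univ.val.map P.od + A.val.map Q.od + Multiset.replicate (∑ a ∈ A, Q.od a) 0 := by
  have h1 : Finset.univ.val.map (P.grow Q A e).od =
      Finset.univ.val.map (fun w => (P.grow Q A e).od (Sum.inl w)) +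
      Multiset.replicate (∑ a ∈ A, Q.od a) 0 := by
    rw [← Finset.univ_disjSum_univ]
    rw [Finset.val_disjSum, Multiset.disjSum, Multiset.map_add, Multiset.map_map, Multiset.map_map]
    congr 1
    refine (Multiset.map_congr rfl (fun x _ => P.grow_od_inr Q A e x)).trans ?_
    rw [Multiset.map_const']
    congr 1
    rw [Q.sum_od, ← Nat.card_coe_set_eq, Finset.card_val, Finset.card_univ,
      ← Nat.card_eq_fintype_card]
    rfl
  have hsplit : (Finset.univ : Finset W).val = A.val.map e + ((A.image e)ᶜ).val := by
    rw [← Finset.image_val_of_injOn he, ← Finset.union_compl (A.image e),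
      Finset.union_val, Multiset.add_eq_union_iff_disjoint.2]
    rw [Finset.disjoint_val]
    exact disjoint_compl_right
  rw [h1, hsplit]
  simp only [Multiset.map_add, Multiset.map_map]
  have h2 : A.val.map ((fun w => (P.grow Q A e).od (Sum.inl w)) ∘ e) = A.val.map Q.od :=
    Multiset.map_congr rfl fun a ha => P.grow_od_mem Q A e he a ha (h0 a ha)
  have h3 : ((A.image e)ᶜ).val.map (fun w => (P.grow Q A e).od (Sum.inl w)) =
      ((A.image e)ᶜ).val.map P.od :=
    Multiset.map_congr rfl fun w hw => P.grow_od_not_mem Q A e w (by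
      intro a ha h
      rw [Finset.mem_val, Finset.mem_compl] at hw
      exact hw (Finset.mem_image.2 ⟨a, ha, h⟩))
  have h4 : A.val.map (P.od ∘ e) = Multiset.replicate A.card 0 := by
    refine (Multiset.map_congr rfl (fun a ha => h0 a ha)).trans ?_
    rw [Multiset.map_const']
    rfl
  rw [h2, h3, h4]
  abel

/-- The parent, with the root being its own parent. -/
def par {W : Type*} (P : PT W) (w : W) : W := (P.p w).getD w

theorem par_lev {W : Type*} (P : PT W) (w : W) : P.lev (P.par w) = P.lev w - 1 := by
  unfold par
  cases h : P.p w with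
  | none => simp [P.pnone _ h, P.lroot]
  | some x => simp [P.hlev _ _ h]

theorem par_iter_lev {W : Type*} (P : PT W) (n : ℕ) (w : W) :
    P.lev (P.par^[n] w) = P.lev w - n := by
  induction n with
  | zero => simp
  | succ n ih => rw [Function.iterate_succ_apply', par_lev, ih]; omega

theorem eq_root {W : Type*} (P : PT W) (w : W) (h : P.lev w = 0) : w = P.root := by
  cases h' : P.p w with
  | none => exact P.pnone w h'
  | some x => have := P.hlev _ _ h'; omega

theorem p_eq {W : Type*} (P : PT W) (w : W) (h : 0 < P.lev w) : P.p w = some (P.par w) := by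
  unfold par
  cases h' : P.p w with
  | none => rw [P.pnone _ h', P.lroot] at h; omega
  | some x => rfl

end PT

namespace PT

theorem dist_par_iter {W : Type*} (P : PT W) (n : ℕ) (w : W) :
    P.graph.dist w (P.par^[n] w) ≤ n := by
  induction n with
  | zero => simp
  | succ n ih =>
    rw [Function.iterate_succ_apply']
    set x := P.par^[n] w
    have h1 := P.connected.dist_triangle (u := w) (v := x) (w := P.par x)
    have h2 : P.graph.dist x (P.par x) ≤ 1 := by
      unfold par
      cases h : P.p x with
      | none => simp
      | some y =>
        have : P.graph.Adj x y := Or.inl h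
        exact (dist_eq_one_iff_adj.2 this).le
    omega

theorem walk_meet {W : Type*} (P : PT W) (u v : W) (q : P.graph.Walk u v) :
    ∃ a b, a + b ≤ q.length ∧ P.par^[a] u = P.par^[b] v := by
  induction q with
  | nil => exact ⟨0, 0, by simp, rfl⟩
  | @cons u x v h q ih =>
    obtain ⟨a, b, hab, heq⟩ := ih
    rw [Walk.length_cons]
    rcases h with h | h
    · refine ⟨a + 1, b, by omega, ?_⟩
      rw [Function.iterate_succ_apply]
      have : P.par u = x := by simp [par, h]
      rw [this, heq]
    · have hx : P.par x = u := by simp [par, h]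
      cases a with
      | zero =>
        refine ⟨0, b + 1, by omega, ?_⟩
        rw [Function.iterate_succ_apply', ← heq]
        exact hx.symm
      | succ a =>
        refine ⟨a, b, by omega, ?_⟩
        rw [← heq, Function.iterate_succ_apply, hx]

theorem dist_leaves {W : Type*} (P : PT W) (D m : ℕ) (u v : W) (hu : P.lev u = D)
    (hv : P.lev v = D) (hm : m + 1 ≤ D) (h1 : P.par^[m + 1] u = P.par^[m + 1] v)
    (h2 : P.par^[m] u ≠ P.par^[m] v) : P.graph.dist u v = 2 * (m + 1) := by
  apply le_antisymm
  · have a1 := P.dist_par_iter (m + 1) u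
    have a2 := P.dist_par_iter (m + 1) v
    rw [dist_comm, ← h1] at a2
    have := P.connected.dist_triangle (u := u) (v := P.par^[m + 1] u) (w := v)
    omega
  · obtain ⟨q, hq⟩ := P.connected.exists_walk_length_eq_dist u v
    obtain ⟨a, b, hab, heq⟩ := P.walk_meet u v q
    by_contra hlt
    have hl := congrArg P.lev heq
    rw [par_iter_lev, par_iter_lev, hu, hv] at hl
    have hc : a = b ∧ a ≤ m ∨ D ≤ a ∧ D ≤ b := by omega
    rcases hc with ⟨rfl, ham⟩ | hc
    · apply h2
      obtain ⟨c, rfl⟩ := Nat.exists_eq_add_of_le ham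
      rw [add_comm, Function.iterate_add_apply, Function.iterate_add_apply, heq]
    · omega

/-- Ancestors of `U` at level `j`. -/
noncomputable def anc {V : Type*} (Q : PT V) (U : Finset V) (D j : ℕ) : Finset V :=
  open Classical in U.image (Q.par^[D - j])

/-- The branching levels below `j`. -/
noncomputable def br {V : Type*} (Q : PT V) (U : Finset V) (D j : ℕ) : Finset ℕ :=
  (Finset.range j).filter fun i => (Q.anc U D i).card ≠ (Q.anc U D (i + 1)).card

open Classical in
theorem anc_succ {V : Type*} (Q : PT V) (U : Finset V) (D j : ℕ) (hj : j < D) :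
    Q.anc U D j = (Q.anc U D (j + 1)).image Q.par := by
  unfold anc
  rw [Finset.image_image, ← Function.iterate_succ']
  congr 2
  have : D - j = (D - (j + 1)).succ := by omega
  rw [this]

theorem anc_lev {V : Type*} (Q : PT V) (U : Finset V) (D j : ℕ) (hj : j ≤ D)
    (hU : ∀ u ∈ U, Q.lev u = D) (a : V) (ha : a ∈ Q.anc U D j) : Q.lev a = j := by
  classical
  unfold anc at ha
  rw [Finset.mem_image] at ha
  obtain ⟨u, hu, rfl⟩ := ha
  rw [par_iter_lev, hU u hu]
  omega

/-- The trivial tree. -/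
def triv : PT PUnit where
  root := PUnit.unit
  p _ := none
  lev _ := 0
  proot := rfl
  pnone _ _ := rfl
  lroot := rfl
  hlev _ _ h := by cases h

theorem build.{u} {V : Type u} [Fintype V] (Q : PT V) (U : Finset V) (D : ℕ)
    (hU : ∀ u ∈ U, Q.lev u = D) (j : ℕ) (hj : j ≤ D) :
    ∃ (W : Type u) (_ : Fintype W) (P : PT W) (e : V → W) (B : Finset V),
      Set.InjOn e (Q.anc U D j) ∧ (∀ a ∈ Q.anc U D j, P.od (e a) = 0) ∧
      (∀ w, P.lev w ≤ (Q.br U D j).card) ∧ (∀ b ∈ B, Q.lev b < j ∧ 0 < Q.od b) ∧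
      Finset.univ.val.map P.od + Multiset.replicate B.card 0 =
        B.val.map Q.od + Multiset.replicate (1 + ∑ b ∈ B, Q.od b) 0 := by
  classical
  induction j with
  | zero =>
    have hod : ∀ w, triv.{u}.od w = 0 := by
      intro w
      simp [od, triv]
    refine ⟨PUnit, inferInstance, triv, fun _ => PUnit.unit, ∅, ?_, fun _ _ => hod _,
      fun _ => Nat.zero_le _, by simp, ?_⟩
    · intro a ha b hb _
      rw [Q.eq_root a (Q.anc_lev U D 0 hj hU a ha), Q.eq_root b (Q.anc_lev U D 0 hj hU b hb)]
    · simp [hod]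
  | succ j ih =>
    obtain ⟨W, _, P, e, B, he, h0, hlev, hB, hseq⟩ := ih (by omega)
    have hs := Q.anc_succ U D j (by omega)
    have hpar : ∀ a ∈ Q.anc U D (j + 1), Q.par a ∈ Q.anc U D j := by
      intro a ha
      rw [hs]
      exact Finset.mem_image_of_mem _ ha
    have hp : ∀ a ∈ Q.anc U D (j + 1), Q.p a = some (Q.par a) := by
      intro a ha
      apply Q.p_eq
      rw [Q.anc_lev U D (j + 1) hj hU a ha]
      omega
    by_cases hc : (Q.anc U D j).card = (Q.anc U D (j + 1)).card
    · have hinj : Set.InjOn Q.par (Q.anc U D (j + 1)) := by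
        rw [← Finset.card_image_iff, ← hs, hc]
      have hbr : Q.br U D (j + 1) = Q.br U D j := by
        unfold br
        rw [Finset.range_add_one, Finset.filter_insert, if_neg (by simpa using hc)]
      refine ⟨W, inferInstance, P, e ∘ Q.par, B, ?_, fun a ha => h0 _ (hpar a ha), ?_, ?_, hseq⟩
      · intro a ha b hb h
        exact hinj ha hb (he (hpar a ha) (hpar b hb) h)
      · rwa [hbr]
      · intro b hb
        exact ⟨by have := (hB b hb).1; omega, (hB b hb).2⟩
    · set A := Q.anc U D j with hA
      have hbr : (Q.br U D (j + 1)).card = (Q.br U D j).card + 1 := by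
        unfold br
        rw [Finset.range_add_one, Finset.filter_insert, if_pos (by simpa using hc),
          Finset.card_insert_of_notMem (by simp)]
      have hmem : ∀ a ∈ Q.anc U D (j + 1), ∃ b ∈ A, Q.p a = some b :=
        fun a ha => ⟨_, hpar a ha, hp a ha⟩
      have hAl : ∀ a ∈ A, Q.lev a = j := Q.anc_lev U D j (by omega) hU
      have hdisj : Disjoint B A := by
        rw [Finset.disjoint_left]
        intro b hb hb'
        have := (hB b hb).1
        rw [hAl b hb'] at this
        omega
      let e' : V → W ⊕ {u : V // ∃ a ∈ A, Q.p u = some a} := fun u =>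
        if h : ∃ a ∈ A, Q.p u = some a then Sum.inr ⟨u, h⟩ else Sum.inl P.root
      have he' : ∀ a (ha : a ∈ Q.anc U D (j + 1)), e' a = Sum.inr ⟨a, hmem a ha⟩ :=
        fun a ha => dif_pos (hmem a ha)
      refine ⟨_, inferInstance, P.grow Q A e, e', B ∪ A, ?_, ?_, ?_, ?_, ?_⟩
      · intro a ha b hb h
        rw [he' a ha, he' b hb] at h
        simpa using h
      · intro a ha
        rw [he' a ha]
        exact P.grow_od_inr Q A e _
      · rw [hbr]
        rintro (w | ⟨u, a, ha, hu⟩)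
        · exact (hlev w).trans (Nat.le_succ _)
        · simpa [grow, hu] using hlev (e a)
      · intro b hb
        rcases Finset.mem_union.1 hb with hb | hb
        · exact ⟨by have := (hB b hb).1; omega, (hB b hb).2⟩
        · refine ⟨by rw [hAl b hb]; omega, ?_⟩
          rw [hs, Finset.mem_image] at hb
          obtain ⟨c, hc, rfl⟩ := hb
          exact (Set.ncard_pos (Set.toFinite _)).2 ⟨c, hp c hc⟩
      · have hg := P.grow_seq Q A e he h0
        rw [Finset.card_union_of_disjoint hdisj, Finset.sum_union hdisj, Finset.union_val,
          ← Multiset.add_eq_union_iff_disjoint.2 (Finset.disjoint_val.2 hdisj), Multiset.map_add,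
          add_comm B.card, Multiset.replicate_add, ← add_assoc, ← add_assoc,
          Multiset.replicate_add]
        rw [show Finset.univ.val.map (P.grow Q A e).od + Multiset.replicate A.card 0 = _ from hg]
        calc _ = (Finset.univ.val.map P.od + Multiset.replicate B.card 0) + A.val.map Q.od
              + Multiset.replicate (∑ a ∈ A, Q.od a) 0 := by abel
          _ = _ := by rw [hseq]; abel

theorem seq_le {W V : Type*} [Fintype W] [Fintype V] (P : PT W) (Q : PT V) (B : Finset V)
    (hB : ∀ b ∈ B, 0 < Q.od b)
    (h : Finset.univ.val.map P.od + Multiset.replicate B.card 0 =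
        B.val.map Q.od + Multiset.replicate (1 + ∑ b ∈ B, Q.od b) 0) :
    Finset.univ.val.map P.od ≤ Finset.univ.val.map Q.od := by
  classical
  rw [← Multiset.add_le_add_iff_right (u := Multiset.replicate B.card 0), h]
  let N : Finset V := Finset.univ.filter fun v => 0 < Q.od v
  have hBN : B ⊆ N := fun b hb => by simp [N, hB b hb]
  have hsub : B ⊆ Finset.univ := Finset.subset_univ _
  have hsplit : ∀ X Y : Finset V, X ⊆ Y → Y.val = X.val + (Y \ X).val := by
    intro X Y hXY
    conv_lhs => rw [← Finset.union_sdiff_of_subset hXY]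
    rw [Finset.union_val, Multiset.add_eq_union_iff_disjoint.2]
    rw [Finset.disjoint_val]
    exact Finset.disjoint_sdiff
  have hz : (Finset.univ \ N).val.map Q.od = Multiset.replicate (Finset.univ \ N).card 0 := by
    have : ∀ v ∈ (Finset.univ \ N).val, Q.od v = 0 := by
      intro v hv
      rw [Finset.mem_val] at hv
      simpa [N] using hv
    refine (Multiset.map_congr rfl this).trans ?_
    rw [Multiset.map_const']
    rfl
  rw [hsplit N Finset.univ (Finset.subset_univ _), Multiset.map_add, hz, hsplit B N hBN,
    Multiset.map_add, add_assoc, add_assoc, ← Multiset.replicate_add]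
  apply add_le_add_right
  refine le_trans ?_ (Multiset.le_add_left _ _)
  rw [Multiset.replicate_le_replicate]
  have c1 : (Finset.univ \ N).card + N.card = Fintype.card V := by
    rw [Finset.card_sdiff_add_card_eq_card (Finset.subset_univ _)]; rfl
  have c2 := Q.sum_univ
  have c3 : ∑ v, Q.od v = ∑ v ∈ N, Q.od v := by
    symm
    apply Finset.sum_subset (Finset.subset_univ _)
    intro v _ hv
    simpa [N] using hv
  have c4 : ∑ v ∈ N, Q.od v = ∑ v ∈ N \ B, Q.od v + ∑ v ∈ B, Q.od v :=
    (Finset.sum_sdiff hBN).symm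
  have c5 : (N \ B).card ≤ ∑ v ∈ N \ B, Q.od v := by
    rw [Finset.card_eq_sum_ones]
    apply Finset.sum_le_sum
    intro v hv
    have : v ∈ N := (Finset.mem_sdiff.1 hv).1
    exact (Finset.mem_filter.1 this).2
  have c6 := Finset.card_sdiff_add_card_eq_card hBN
  omega

theorem height_le {V : Type*} [Fintype V] (Q : PT V) (U : Finset V) (D : ℕ)
    (hU : ∀ u ∈ U, Q.lev u = D) :
    hSeqK (Finset.univ.val.map Q.od) U.card ≤ (Q.br U D D).card := by
  classical
  obtain ⟨W, _, P, e, B, he, h0, hlev, hB, hseq⟩ := Q.build U D hU D le_rfl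
  have hA : Q.anc U D D = U := by simp [anc]
  rw [hA] at he h0
  refine P.feas _ _ _ hlev (P.seq_le Q B (fun b hb => (hB b hb).2) hseq) ?_
  rw [← Set.ncard_coe_finset, ← Set.ncard_image_of_injOn he]
  apply Set.ncard_le_ncard _ (Set.toFinite _)
  rintro _ ⟨u, hu, rfl⟩
  exact h0 u hu

theorem card_dist {V : Type*} [Fintype V] (Q : PT V) (U : Finset V) (D : ℕ)
    (hU : ∀ u ∈ U, Q.lev u = D) (hne : U.Nonempty)
    (hfin : {n : ℕ | ∃ u ∈ U, ∃ v ∈ U, Q.graph.dist u v = n}.Finite) :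
    (Q.br U D D).card + 1 ≤ {n : ℕ | ∃ u ∈ U, ∃ v ∈ U, Q.graph.dist u v = n}.ncard := by
  classical
  let F : Finset ℕ := insert 0 ((Q.br U D D).image fun i => 2 * (D - i))
  have hlt : ∀ i ∈ Q.br U D D, i < D := fun i hi => by
    simpa using (Finset.mem_filter.1 hi).1
  have hF : F.card = (Q.br U D D).card + 1 := by
    rw [Finset.card_insert_of_notMem, Finset.card_image_of_injOn]
    · intro a ha b hb h
      have := hlt a ha
      have := hlt b hb
      simp only at h
      omega
    · intro h
      obtain ⟨i, hi, h⟩ := Finset.mem_image.1 h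
      have := hlt i hi
      omega
  rw [← hF, ← Set.ncard_coe_finset]
  apply Set.ncard_le_ncard _ hfin
  intro n hn
  rcases Finset.mem_insert.1 (Finset.mem_coe.1 hn) with rfl | hn
  · obtain ⟨u, hu⟩ := hne
    exact ⟨u, hu, u, hu, by simp⟩
  · obtain ⟨i, hi, rfl⟩ := Finset.mem_image.1 hn
    have hiD := hlt i hi
    have hcard := (Finset.mem_filter.1 hi).2
    have hs := Q.anc_succ U D i hiD
    have : ¬ Set.InjOn Q.par (Q.anc U D (i + 1)) := by
      rw [← Finset.card_image_iff, ← hs]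
      exact hcard
    unfold Set.InjOn at this
    push Not at this
    obtain ⟨a, ha, b, hb, hab, hne'⟩ := this
    simp only [anc, Finset.mem_coe, Finset.mem_image] at ha hb
    obtain ⟨u, hu, rfl⟩ := ha
    obtain ⟨v, hv, rfl⟩ := hb
    refine ⟨u, hu, v, hv, ?_⟩
    rw [Q.dist_leaves D (D - (i + 1)) u v (hU u hu) (hU v hv) (by omega) _ hne']
    · omega
    · rw [Function.iterate_succ_apply', Function.iterate_succ_apply', hab]

end PT

theorem stmt_10 {V : Type*} [Fintype V] (G : SimpleGraph V) (r : V) (hT : G.IsTree)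
    (U : Finset V) (hU : ∀ u ∈ U, IsRLeaf G r u)
    (hdepth : ∀ u ∈ U, ∀ v ∈ U, G.dist r u = G.dist r v)
    (k : ℕ) (hk : U.card = k) (hk1 : 1 ≤ k) :
    hSeqK (outDegSeq G r) k + 1 ≤ {n : ℕ | ∃ u ∈ U, ∃ v ∈ U, G.dist u v = n}.ncard ∧
      hSeqK (outDegSeq G r) k + 1 ≤ (lpSet G).ncard := by
  classical
  obtain ⟨Q, hr, hp, hlev⟩ := exists_PT G r hT
  have hG : G = Q.graph := by
    ext u v
    show _ ↔ (Q.p u = some v ∨ Q.p v = some u)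
    rw [hp, hp]
    constructor
    · intro h
      rcases hT.dist_eq_dist_add_one_of_adj r h with h' | h'
      · exact Or.inl ⟨h.symm, h'⟩
      · exact Or.inr ⟨h, h'⟩
    · rintro (h | h)
      · exact h.1.symm
      · exact h.1
  subst hr
  subst hG
  subst hk
  have hne : U.Nonempty := Finset.card_pos.1 hk1
  obtain ⟨u0, hu0⟩ := hne
  have hD : ∀ u ∈ U, Q.lev u = Q.lev u0 := fun u hu => by
    rw [hlev, hlev]; exact hdepth u hu u0 hu0
  have hfin : ∀ p : V → V → Prop, {n : ℕ | ∃ u v, p u v ∧ Q.graph.dist u v = n}.Finite := by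
    intro p
    apply (Set.finite_range (fun x : V × V => Q.graph.dist x.1 x.2)).subset
    rintro n ⟨u, v, -, rfl⟩
    exact ⟨(u, v), rfl⟩
  have hseq : outDegSeq Q.graph Q.root = Finset.univ.val.map Q.od := by
    unfold outDegSeq
    rw [show outdeg Q.graph Q.root = Q.od from funext Q.outdeg_eq]
  have hlpfin : (lpSet Q.graph).Finite := by
    apply (hfin fun _ _ => True).subset
    rintro n ⟨u, v, -, -, h⟩
    exact ⟨u, v, trivial, h⟩
  have hleaf : ∀ u ∈ U, IsLeafV Q.graph u := by
    intro u hu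
    unfold IsLeafV gdeg
    rw [Set.ncard_le_one (Set.toFinite _)]
    have key : ∀ a, Q.graph.Adj u a → Q.p u = some a := by
      rintro a (h | h)
      · exact h
      · exact absurd ((hp _ _).1 h) (hU u hu a)
    intro a ha b hb
    have h1 := key a ha
    rw [key b hb] at h1
    exact (Option.some.inj h1).symm
  have hsub : {n : ℕ | ∃ u ∈ U, ∃ v ∈ U, Q.graph.dist u v = n} ⊆ lpSet Q.graph := by
    rintro n ⟨u, hu, v, hv, h⟩
    exact ⟨u, v, hleaf u hu, hleaf v hv, h⟩
  have h1 := Q.height_le U _ hD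
  have h2 := Q.card_dist U _ hD ⟨u0, hu0⟩ (hlpfin.subset hsub)
  have h3 := Set.ncard_le_ncard hsub hlpfin
  rw [hseq]
  omega
end

section
/- Let (T, r) be a rooted tree, let v be the lowest common ancestor of leaves u₁, …, u_k (k ≥ 2) of (T, r), let w₁, …, w_{d'} be those children of v whose rooted subtrees contain at least one uᵢ, and for i ∈ {1, …, d'} let s_i⁺ be the out-degree sequence of the rooted subtree (T_i, w_i) of (T, r) at w_i and k_i the number of the leaves u₁, …, u_k lying in T_i. If s⁺ is the out-degree sequence of (T, r), then h(s⁺, k) ≤ max{ h(s_i⁺, k_i) : i ∈ {1, …, d'} } + 1. -/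
open SimpleGraph

/-- Rooted trees given by a parent function and a depth function. -/
structure RTree (W : Type*) where
  par : W → Option W
  dep : W → ℕ
  root : W
  par_none : ∀ x, par x = none ↔ x = root
  dep_root : dep root = 0
  dep_par : ∀ x y, par x = some y → dep x = dep y + 1

namespace RTree

noncomputable def cc {W : Type*} (t : RTree W) (x : W) : ℕ := {y | t.par y = some x}.ncard

noncomputable def seq {W : Type*} [Fintype W] (t : RTree W) : Multiset ℕ :=
  ∑ x, {t.cc x}

def leaves {W : Type*} (t : RTree W) : Set W := {x | ∀ y, t.par y ≠ some x}

def gr {W : Type*} (t : RTree W) : SimpleGraph W where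
  Adj x y := t.par x = some y ∨ t.par y = some x
  symm := ⟨fun x y h => h.symm⟩
  loopless := ⟨fun x h => by
    have := t.dep_par x x (by simpa using h)
    omega⟩

lemma exists_walk {W : Type*} (t : RTree W) (n : ℕ) :
    ∀ x, t.dep x = n → ∃ p : t.gr.Walk t.root x, p.length = n := by
  induction n with
  | zero =>
    intro x hx
    have : x = t.root := by
      rw [← t.par_none]
      rcases h : t.par x with _ | y
      · rfl
      · have := t.dep_par x y h; omega
    subst this
    exact ⟨SimpleGraph.Walk.nil, rfl⟩
  | succ n ih =>
    intro x hx
    rcases h : t.par x with _ | y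
    · rw [t.par_none] at h
      subst h
      rw [t.dep_root] at hx; omega
    · have := t.dep_par x y h
      obtain ⟨p, hp⟩ := ih y (by omega)
      have ha : t.gr.Adj y x := Or.inr h
      exact ⟨p.concat ha, by simp [hp]⟩

lemma conn {W : Type*} (t : RTree W) : t.gr.Connected := by
  have h : ∀ x, t.gr.Reachable t.root x := fun x => by
    obtain ⟨p, _⟩ := t.exists_walk _ x rfl
    exact ⟨p⟩
  have : Nonempty W := ⟨t.root⟩
  exact ⟨fun x y => (h x).symm.trans (h y)⟩

lemma dep_le_walk {W : Type*} (t : RTree W) {x y : W} (p : t.gr.Walk x y) :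
    t.dep y ≤ t.dep x + p.length := by
  induction p with
  | nil => simp
  | cons h p ih =>
    rw [SimpleGraph.Walk.length_cons]
    rcases h with h | h
    · have := t.dep_par _ _ h; omega
    · have := t.dep_par _ _ h; omega

lemma dist_root {W : Type*} (t : RTree W) (x : W) : t.gr.dist t.root x = t.dep x := by
  apply le_antisymm
  · obtain ⟨p, hp⟩ := t.exists_walk _ x rfl
    rw [← hp]; exact SimpleGraph.dist_le p
  · obtain ⟨p, hp⟩ := t.conn.exists_walk_length_eq_dist t.root x
    have := t.dep_le_walk p
    rw [t.dep_root] at this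
    omega

lemma isChild_iff {W : Type*} (t : RTree W) (x y : W) :
    IsChild t.gr t.root x y ↔ t.par y = some x := by
  unfold IsChild
  rw [dist_root, dist_root]
  constructor
  · rintro ⟨h | h, h2⟩
    · have := t.dep_par _ _ h; omega
    · exact h
  · intro h
    exact ⟨Or.inr h, t.dep_par _ _ h⟩

lemma isTree {W : Type*} [Finite W] (t : RTree W) : t.gr.IsTree := by
  rw [SimpleGraph.isTree_iff_connected_and_card]
  refine ⟨t.conn, le_antisymm ?_ t.conn.card_vert_le_card_edgeSet_add_one⟩
  classical
  have := Fintype.ofFinite W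
  let f : {x : W // x ≠ t.root} → Sym2 W := fun x => s(x.1, (t.par x.1).getD x.1)
  have hsub : t.gr.edgeSet ⊆ Set.range f := by
    intro e
    induction e using Sym2.ind with
    | _ x y =>
      intro h
      have key : ∀ x y, t.par x = some y → s(x, y) ∈ Set.range f := by
        intro x y h
        refine ⟨⟨x, fun hx => ?_⟩, ?_⟩
        · rw [← t.par_none] at hx; simp [hx] at h
        · simp [f, h]
      rcases h with h | h
      · exact key _ _ h
      · rw [Sym2.eq_swap]; exact key _ _ h
  have h1 : Nat.card t.gr.edgeSet ≤ Nat.card (Set.range f) :=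
    Nat.card_mono (Set.toFinite _) hsub
  have h2 : Nat.card (Set.range f) ≤ Nat.card {x : W // x ≠ t.root} :=
    Finite.card_range_le f
  have h3 : Nat.card {x : W // x ≠ t.root} + 1 = Nat.card W := by
    rw [Nat.card_eq_fintype_card, Nat.card_eq_fintype_card, Fintype.card_subtype_compl,
      Fintype.card_subtype_eq]
    have : 0 < Fintype.card W := Fintype.card_pos_iff.mpr ⟨t.root⟩
    omega
  omega

lemma outdeg_eq {W : Type*} (t : RTree W) (x : W) : outdeg t.gr t.root x = t.cc x := by
  unfold outdeg cc
  congr 1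
  ext y
  exact t.isChild_iff x y


lemma map_eq_sum {W : Type*} (f : W → ℕ) (s : Finset W) :
    Multiset.map f s.val = ∑ x ∈ s, {f x} := by
  classical
  induction s using Finset.induction_on with
  | empty => simp
  | insert a s ha ih => simp [Finset.sum_insert ha, Finset.insert_val_of_notMem ha, ih]

/-- Transport along an equivalence. -/
def map {W X : Type*} (t : RTree W) (e : W ≃ X) : RTree X where
  par x := (t.par (e.symm x)).map e
  dep x := t.dep (e.symm x)
  root := e t.root
  par_none x := by
    rw [Option.map_eq_none_iff, t.par_none, Equiv.symm_apply_eq]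
  dep_root := by simp [t.dep_root]
  dep_par x y h := by
    rw [Option.map_eq_some_iff] at h
    obtain ⟨z, hz, rfl⟩ := h
    simpa using t.dep_par _ _ hz

lemma map_par {W X : Type*} (t : RTree W) (e : W ≃ X) (x y : W) :
    (t.map e).par (e x) = some (e y) ↔ t.par x = some y := by
  simp [map]

lemma map_cc {W X : Type*} (t : RTree W) (e : W ≃ X) (x : W) :
    (t.map e).cc (e x) = t.cc x := by
  unfold cc
  rw [← Set.ncard_image_of_injective _ e.injective]
  congr 1
  ext y
  obtain ⟨y, rfl⟩ := e.surjective y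
  simp [map_par]

lemma map_seq {W X : Type*} [Fintype W] [Fintype X] (t : RTree W) (e : W ≃ X) :
    (t.map e).seq = t.seq := by
  unfold seq
  rw [← Equiv.sum_comp e]
  simp [map_cc]

lemma map_leaves {W X : Type*} (t : RTree W) (e : W ≃ X) :
    (t.map e).leaves.ncard = t.leaves.ncard := by
  rw [← Set.ncard_image_of_injective t.leaves e.injective]
  congr 1
  ext y
  obtain ⟨y, rfl⟩ := e.surjective y
  simp only [leaves, Set.mem_ofPred_eq, EmbeddingLike.apply_eq_iff_eq, Set.mem_image,
    exists_eq_right]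
  rw [← e.forall_congr_right]
  simp [map_par]

lemma feas {W : Type*} [Fintype W] (t : RTree W) (s : Multiset ℕ) (k H : ℕ)
    (hs : t.seq ≤ s) (hk : k ≤ t.leaves.ncard) (hH : ∀ x, t.dep x ≤ H) :
    ∃ h ∈ hFeas s k, h ≤ H := by
  let e := Fintype.equivFin W
  let u := t.map e
  refine ⟨rheight u.gr u.root, ⟨_, u.gr, u.root, u.isTree, ?_, ?_, rfl⟩, ?_⟩
  · unfold outDegSeq
    rw [map_eq_sum]
    simp only [outdeg_eq]
    change u.seq ≤ s
    rw [map_seq]; exact hs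
  · have : {v | IsRLeaf u.gr u.root v} = u.leaves := by
      ext v
      simp [IsRLeaf, leaves, isChild_iff]
    rw [this, map_leaves]; exact hk
  · refine csSup_le (s := {d | ∃ v, u.gr.dist u.root v = d}) ⟨_, u.root, rfl⟩ ?_
    rintro d ⟨x, rfl⟩
    rw [dist_root]
    exact hH _

/-- Every rooted tree graph is represented. -/
lemma of_isTree {V : Type*} (G : SimpleGraph V) (r : V) (hT : G.IsTree) :
    ∃ t : RTree V, t.root = r ∧ (∀ x, t.dep x = G.dist r x) ∧
      ∀ x y, IsChild G r x y ↔ t.par y = some x := by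
  classical
  have hex : ∀ x, x ≠ r → ∃ y, IsChild G r y x := by
    intro x hx
    obtain ⟨p, hp⟩ := hT.connected.exists_walk_length_eq_dist r x
    have hnn : ¬ p.Nil := SimpleGraph.Walk.not_nil_of_ne hx.symm
    have ha := p.adj_penultimate hnn
    refine ⟨p.penultimate, ha, ?_⟩
    have h1 : G.dist r p.penultimate ≤ p.dropLast.length := SimpleGraph.dist_le _
    have h3 := SimpleGraph.Walk.length_dropLast_add_one hnn
    have h2 : G.dist r x ≤ G.dist r p.penultimate + G.dist p.penultimate x :=
      hT.connected.dist_triangle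
    rw [SimpleGraph.dist_eq_one_iff_adj.mpr ha] at h2
    omega
  have huniq : ∀ x y z, IsChild G r y x → IsChild G r z x → y = z := by
    intro x y z ⟨hy, hy'⟩ ⟨hz, hz'⟩
    obtain ⟨p, hp⟩ := hT.connected.exists_walk_length_eq_dist r y
    obtain ⟨q, hq⟩ := hT.connected.exists_walk_length_eq_dist r z
    have hp' : (p.concat hy).IsPath := SimpleGraph.Walk.isPath_of_length_eq_dist _ (by
      rw [SimpleGraph.Walk.length_concat]; omega)
    have hq' : (q.concat hz).IsPath := SimpleGraph.Walk.isPath_of_length_eq_dist _ (by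
      rw [SimpleGraph.Walk.length_concat]; omega)
    have := (hT.existsUnique_path r x).unique hp' hq'
    exact (SimpleGraph.Walk.concat_inj this).1
  have hnr : ∀ y, ¬ IsChild G r y r := by
    intro y h
    have := h.2
    simp at this
  have hpar : ∀ x y, IsChild G r x y ↔
      (if h : ∃ z, IsChild G r z y then some h.choose else none) = some x := by
    intro x y
    constructor
    · intro h
      have hz : ∃ z, IsChild G r z y := ⟨x, h⟩
      rw [dif_pos hz]
      exact congrArg some (huniq _ _ _ hz.choose_spec h)
    · intro h
      split_ifs at h with hz
      have := Option.some.inj h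
      rw [← this]
      exact hz.choose_spec
  refine ⟨⟨fun y => if h : ∃ z, IsChild G r z y then some h.choose else none,
    fun x => G.dist r x, r, ?_, by simp, ?_⟩, rfl, fun x => rfl, hpar⟩
  · intro x
    constructor
    · intro h
      by_contra hx
      rw [dif_pos (hex x hx)] at h
      exact absurd h (by simp)
    · rintro rfl
      rw [dif_neg]
      rintro ⟨z, hz⟩
      exact hnr z hz
  · intro x y h
    exact ((hpar y x).mpr h).2

end RTree
namespace RTree

def Desc {W : Type*} (t : RTree W) (a x : W) : Prop :=
  Relation.ReflTransGen (fun a b => t.par b = some a) a x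

lemma Desc.dep_le {W : Type*} {t : RTree W} {a x : W} (h : t.Desc a x) : t.dep a ≤ t.dep x := by
  induction h with
  | refl => exact le_rfl
  | tail _ hbc ih => have := t.dep_par _ _ hbc; omega

lemma Desc.unique {W : Type*} {t : RTree W} {a b x : W} (h : t.Desc a x) :
    t.Desc b x → t.dep a = t.dep b → a = b := by
  induction h with
  | refl =>
    intro hb hd
    rcases Relation.ReflTransGen.cases_tail hb with h | ⟨c, hc, hca⟩
    · exact h
    · have h1 := t.dep_par _ _ hca
      have h2 := Desc.dep_le hc
      omega
  | @tail y x hay hyx ih =>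
    intro hb hd
    rcases Relation.ReflTransGen.cases_tail hb with h | ⟨c, hc, hca⟩
    · subst h
      have h1 := t.dep_par _ _ hyx
      have h2 := Desc.dep_le hay
      omega
    · have : c = y := Option.some.inj (hca.symm.trans hyx)
      subst this
      exact ih hc hd

lemma exists_sub {W : Type*} (t : RTree W) (w : W) :
    ∃ u : RTree {x // t.Desc w x}, ∀ x y, u.par y = some x ↔ t.par y.1 = some x.1 := by
  classical
  have hpar : ∀ x y : {x // t.Desc w x},
      ((t.par y.1).bind (fun z => if h : t.Desc w z then some (⟨z, h⟩ : {x // t.Desc w x})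
        else none)) = some x ↔ t.par y.1 = some x.1 := by
    intro x y
    rw [Option.bind_eq_some_iff]
    constructor
    · rintro ⟨z, hz, h⟩
      split_ifs at h with hd
      rw [hz, ← Option.some.inj h]
    · intro h
      exact ⟨x.1, h, by rw [dif_pos x.2]⟩
  refine ⟨⟨fun y => (t.par y.1).bind
    (fun z => if h : t.Desc w z then some (⟨z, h⟩ : {x // t.Desc w x}) else none),
    fun y => t.dep y.1 - t.dep w, ⟨w, Relation.ReflTransGen.refl⟩, ?_, by simp, ?_⟩, hpar⟩
  · rintro ⟨y, hy⟩
    constructor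
    · intro h
      rcases Relation.ReflTransGen.cases_tail hy with h' | ⟨c, hc, hca⟩
      · exact Subtype.ext h'
      · have := (hpar ⟨c, hc⟩ ⟨y, hy⟩).mpr hca
        rw [h] at this
        exact absurd this (by simp)
    · intro h
      have hyw : y = w := congrArg Subtype.val h
      rw [Option.eq_none_iff_forall_ne_some]
      intro x hx
      rw [hpar] at hx
      have h1 := t.dep_par _ _ hx
      have h2 := Desc.dep_le x.2
      simp only [hyw] at h1
      omega
  · intro x y h
    rw [hpar] at h
    have h1 := t.dep_par _ _ h
    have h2 := Desc.dep_le y.2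
    omega

lemma sub_cc {W : Type*} (t : RTree W) (w : W) (u : RTree {x // t.Desc w x})
    (hu : ∀ x y, u.par y = some x ↔ t.par y.1 = some x.1) (x) : u.cc x = t.cc x.1 := by
  unfold cc
  rw [← Set.ncard_image_of_injective _ Subtype.val_injective]
  congr 1
  ext y
  simp only [hu, Set.mem_image, Set.mem_ofPred_eq, Subtype.exists, exists_and_right,
    exists_eq_right, exists_prop]
  constructor
  · rintro ⟨_, h⟩; exact h
  · intro h
    exact ⟨Relation.ReflTransGen.tail x.2 h, h⟩

/-- Joining a family of rooted trees below a new root. -/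
def join {ι : Type*} {W : ι → Type*} (t : ∀ i, RTree (W i)) : RTree (Option (Σ i, W i)) where
  par x := match x with
    | none => none
    | some ⟨i, a⟩ => some (((t i).par a).map (fun b => ⟨i, b⟩))
  dep x := match x with
    | none => 0
    | some ⟨i, a⟩ => (t i).dep a + 1
  root := none
  par_none x := by
    rcases x with _ | ⟨i, a⟩ <;> simp
  dep_root := rfl
  dep_par x y h := by
    rcases x with _ | ⟨i, a⟩
    · simp at h
    · have h' := Option.some.inj h
      rcases hp : (t i).par a with _ | b
      · rw [hp] at h'
        simp only [Option.map_none] at h'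
        subst h'
        have : a = (t i).root := ((t i).par_none a).mp hp
        simp [this, (t i).dep_root]
      · rw [hp] at h'
        simp only [Option.map_some] at h'
        subst h'
        simp [(t i).dep_par _ _ hp]

lemma join_par_none {ι : Type*} {W : ι → Type*} (t : ∀ i, RTree (W i)) (x) :
    (join t).par x = some none ↔ ∃ i, x = some ⟨i, (t i).root⟩ := by
  rcases x with _ | ⟨i, a⟩
  · simp [join]
  · simp only [join, Option.some.injEq, Option.map_eq_none_iff, (t i).par_none, Sigma.mk.injEq]
    constructor
    · rintro rfl; exact ⟨i, rfl, HEq.rfl⟩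
    · rintro ⟨j, rfl, h⟩; exact eq_of_heq h

lemma join_par_some {ι : Type*} {W : ι → Type*} (t : ∀ i, RTree (W i)) (x) (i : ι) (a : W i) :
    (join t).par x = some (some ⟨i, a⟩) ↔ ∃ b, x = some ⟨i, b⟩ ∧ (t i).par b = some a := by
  rcases x with _ | ⟨j, c⟩
  · simp [join]
  · simp only [join, Option.some.injEq, Option.map_eq_some_iff, Sigma.mk.injEq]
    constructor
    · rintro ⟨b, hb, rfl, h⟩
      have := eq_of_heq h
      subst this
      exact ⟨c, ⟨rfl, HEq.rfl⟩, hb⟩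
    · rintro ⟨b, ⟨rfl, h⟩, hb⟩
      have := eq_of_heq h
      subst this
      exact ⟨a, hb, rfl, HEq.rfl⟩

lemma join_cc_none {ι : Type*} [Fintype ι] {W : ι → Type*} (t : ∀ i, RTree (W i)) :
    (join t).cc none = Fintype.card ι := by
  unfold cc
  have : {y | (join t).par y = some none} =
      (fun i => (some ⟨i, (t i).root⟩ : Option (Σ i, W i))) '' Set.univ := by
    ext x
    rw [Set.mem_ofPred_eq, join_par_none]
    simp only [Set.image_univ, Set.mem_range]
    exact exists_congr fun i => eq_comm
  rw [this, Set.ncard_image_of_injective, Set.ncard_univ, Nat.card_eq_fintype_card]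
  intro i j h
  simp only [Option.some.injEq, Sigma.mk.injEq] at h
  exact h.1

lemma join_cc_some {ι : Type*} {W : ι → Type*} (t : ∀ i, RTree (W i)) (i : ι) (a : W i) :
    (join t).cc (some ⟨i, a⟩) = (t i).cc a := by
  unfold cc
  have : {y | (join t).par y = some (some ⟨i, a⟩)} =
      (fun b => (some ⟨i, b⟩ : Option (Σ i, W i))) '' {b | (t i).par b = some a} := by
    ext x
    simp only [join_par_some, Set.mem_ofPred_eq, Set.mem_image]
    constructor
    · rintro ⟨b, rfl, h⟩; exact ⟨b, h, rfl⟩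
    · rintro ⟨b, h, rfl⟩; exact ⟨b, rfl, h⟩
  rw [this, Set.ncard_image_of_injective]
  intro b c h
  simpa using h

lemma join_seq {ι : Type*} [Fintype ι] {W : ι → Type*} [∀ i, Fintype (W i)]
    (t : ∀ i, RTree (W i)) :
    (join t).seq = {Fintype.card ι} + ∑ i, (t i).seq := by
  unfold seq
  rw [Fintype.sum_option, Fintype.sum_sigma, join_cc_none]
  simp only [join_cc_some]

lemma join_leaves {ι : Type*} [Fintype ι] {W : ι → Type*} [∀ i, Fintype (W i)]
    (t : ∀ i, RTree (W i)) :
    ∑ i, (t i).leaves.ncard ≤ (join t).leaves.ncard := by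
  classical
  have h1 : ∑ i, (t i).leaves.ncard =
      (Finset.univ.sigma (fun i => ((t i).leaves.toFinite.toFinset))).card := by
    rw [Finset.card_sigma]
    refine Finset.sum_congr rfl fun i _ => ?_
    rw [Set.ncard_eq_toFinset_card _]
  rw [h1, ← Set.ncard_coe_finset,
    ← Set.ncard_image_of_injective _ (Option.some_injective (Σ i, W i))]
  apply Set.ncard_le_ncard _ (Set.toFinite _)
  rintro _ ⟨⟨i, a⟩, ha, rfl⟩
  simp only [Finset.coe_sigma, Finset.coe_univ, Set.Finite.coe_toFinset, Set.mem_sigma_iff,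
    Set.mem_univ, true_and] at ha
  intro y hy
  rw [join_par_some] at hy
  obtain ⟨b, _, hb⟩ := hy
  exact ha b hb

/-- The one-vertex tree. -/
def single : RTree (Fin 1) where
  par _ := none
  dep _ := 0
  root := 0
  par_none x := by simp [Subsingleton.elim x 0]
  dep_root := rfl
  dep_par x y h := by simp at h

lemma single_seq : single.seq = {0} := by
  simp [seq, cc, single]

lemma ancestor_iff {V : Type*} {G : SimpleGraph V} {r : V} (hT : G.IsTree) (t : RTree V)
    (hc : ∀ x y, IsChild G r x y ↔ t.par y = some x)
    (w x : V) : Ancestor G r w x ↔ t.Desc w x := by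
  constructor
  · have key : ∀ n x, G.dist w x = n → Ancestor G r w x → t.Desc w x := by
      intro n
      induction n with
      | zero =>
        intro x hx _
        rw [hT.connected.dist_eq_zero_iff] at hx
        subst hx
        exact Relation.ReflTransGen.refl
      | succ n ih =>
        intro x hx ha
        unfold Ancestor at ha
        obtain ⟨p, hp⟩ := hT.connected.exists_walk_length_eq_dist w x
        have hne : w ≠ x := by
          rintro rfl
          simp at hx
        have hnn : ¬ p.Nil := SimpleGraph.Walk.not_nil_of_ne hne
        have hadj := p.adj_penultimate hnn
        have h1 : G.dist w p.penultimate ≤ p.dropLast.length := SimpleGraph.dist_le _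
        have h3 := SimpleGraph.Walk.length_dropLast_add_one hnn
        have h2 : G.dist r x ≤ G.dist r p.penultimate + G.dist p.penultimate x :=
          hT.connected.dist_triangle
        have h4 : G.dist r p.penultimate ≤ G.dist r w + G.dist w p.penultimate :=
          hT.connected.dist_triangle
        rw [SimpleGraph.dist_eq_one_iff_adj.mpr hadj] at h2
        refine Relation.ReflTransGen.tail (ih p.penultimate (by omega) ?_) ?_
        · unfold Ancestor; omega
        · rw [← hc]
          exact ⟨hadj, by omega⟩
    exact key _ x rfl
  · intro h
    induction h with
    | refl => simp [Ancestor]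
    | @tail a b _ hab ih =>
      rw [← hc] at hab
      unfold Ancestor at ih ⊢
      have h1 : G.dist r b ≤ G.dist r w + G.dist w b := hT.connected.dist_triangle
      have h2 : G.dist w b ≤ G.dist w a + G.dist a b := hT.connected.dist_triangle
      rw [SimpleGraph.dist_eq_one_iff_adj.mpr hab.1] at h2
      have := hab.2
      omega

end RTree
/-- Let `v` be the lowest common ancestor of a set `U` of `k ≥ 2` leaves of a rooted tree
`(T, r)` with out-degree sequence `s⁺`. For each child `w` of `v` whose rooted subtree
contains at least one element of `U`, let `s_w⁺` be the out-degree sequence of that rooted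
subtree and `k_w` the number of elements of `U` in it. Then
`h(s⁺, k) ≤ max_w h(s_w⁺, k_w) + 1`. -/
theorem stmt_11 {V : Type*} [Fintype V] (G : SimpleGraph V) (r : V) (hT : G.IsTree)
    (U : Finset V) (hU : ∀ u ∈ U, IsRLeaf G r u) (k : ℕ) (hk : U.card = k) (hk2 : 2 ≤ k)
    (v : V) (hanc : ∀ u ∈ U, Ancestor G r v u)
    (hlca : ∀ w : V, (∀ u ∈ U, Ancestor G r w u) → Ancestor G r w v) :
    hSeqK (outDegSeq G r) k ≤
      sSup {m : ℕ | ∃ w : V, IsChild G r v w ∧ (∃ u ∈ U, Ancestor G r w u) ∧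
        m = hSeqK (subSeq G r w) ({u : V | u ∈ U ∧ Ancestor G r w u}).ncard} + 1 := by
  classical
  obtain ⟨t, -, hdep, hch⟩ := RTree.of_isTree G r hT
  have hanc_iff := RTree.ancestor_iff hT t hch
  have hout : ∀ x, outdeg G r x = t.cc x := by
    intro x
    unfold outdeg RTree.cc
    congr 1
    ext y
    exact hch x y
  have hsubSeq : ∀ w, subSeq G r w = ∑ x ∈ Finset.univ.filter (fun x => t.Desc w x), {t.cc x} := by
    intro w
    rw [← RTree.map_eq_sum, Finset.filter_val]
    unfold subSeq
    simp only [hanc_iff]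
    exact Multiset.map_congr rfl fun x _ => hout x
  have hfull : outDegSeq G r = ∑ x, {t.cc x} := by
    unfold outDegSeq
    rw [RTree.map_eq_sum]
    simp only [hout]
  set S : Set ℕ := {m : ℕ | ∃ w : V, IsChild G r v w ∧ (∃ u ∈ U, Ancestor G r w u) ∧
        m = hSeqK (subSeq G r w) ({u : V | u ∈ U ∧ Ancestor G r w u}).ncard} with hS
  have hSb : BddAbove S := by
    apply Set.Finite.bddAbove
    apply (Set.finite_range (fun w : V => hSeqK (subSeq G r w)
      ({u : V | u ∈ U ∧ Ancestor G r w u}).ncard)).subset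
    rintro m ⟨w, _, _, rfl⟩
    exact ⟨w, rfl⟩
  have hA : ∀ w : {w // IsChild G r v w}, ∃ (m : ℕ) (u : RTree (Fin m)),
      u.seq ≤ subSeq G r w.1 ∧ ({u : V | u ∈ U ∧ Ancestor G r w.1 u}).ncard ≤ u.leaves.ncard ∧
      ∀ x, u.dep x ≤ sSup S := by
    rintro ⟨w, hw⟩
    by_cases hrel : ∃ u ∈ U, Ancestor G r w u
    · have hne : (hFeas (subSeq G r w) ({u : V | u ∈ U ∧ Ancestor G r w u}).ncard).Nonempty := by
        obtain ⟨u, hu⟩ := t.exists_sub w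
        obtain ⟨h, hh, -⟩ := u.feas (subSeq G r w) ({u : V | u ∈ U ∧ Ancestor G r w u}).ncard
          (Finset.univ.sup u.dep) (by
            rw [hsubSeq, RTree.seq]
            simp only [t.sub_cc w u hu]
            rw [Finset.sum_subtype (p := fun x => t.Desc w x) _ (by simp)]) (by
            rw [← Set.ncard_image_of_injective u.leaves Subtype.val_injective]
            apply Set.ncard_le_ncard _ (Set.toFinite _)
            rintro x ⟨hxU, hx⟩
            rw [hanc_iff] at hx
            refine ⟨⟨x, hx⟩, ?_, rfl⟩
            intro y hy
            rw [hu] at hy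
            exact hU x hxU y.1 ((hch _ _).mpr hy)) (fun x => Finset.le_sup (Finset.mem_univ x))
        exact ⟨h, hh⟩
      obtain ⟨m, G', r', hT', hs', hl', hh'⟩ := Nat.sInf_mem hne
      obtain ⟨u, -, hud, huc⟩ := RTree.of_isTree G' r' hT'
      refine ⟨m, u, ?_, ?_, ?_⟩
      · refine le_trans (le_of_eq ?_) hs'
        unfold outDegSeq
        rw [RTree.map_eq_sum]
        refine Finset.sum_congr rfl fun x _ => ?_
        unfold outdeg RTree.cc
        simp only [huc]
      · refine hl'.trans (le_of_eq ?_)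
        simp only [IsRLeaf, huc, RTree.leaves, ne_eq]
      · intro x
        have h1 : u.dep x ≤ rheight G' r' := by
          rw [hud]
          exact le_csSup (Set.finite_range (G'.dist r')).bddAbove ⟨x, rfl⟩
        refine h1.trans ?_
        rw [hh']
        exact le_csSup hSb ⟨w, hw, hrel, rfl⟩
    · refine ⟨1, RTree.single, ?_, ?_, fun x => Nat.zero_le _⟩
      · rw [RTree.single_seq, hsubSeq]
        obtain ⟨x, hx, hmax⟩ := Finset.exists_max_image
          (Finset.univ.filter (fun x => t.Desc w x)) t.dep
          ⟨w, Finset.mem_filter.mpr ⟨Finset.mem_univ _, Relation.ReflTransGen.refl⟩⟩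
        have h0 : t.cc x = 0 := by
          unfold RTree.cc
          rw [Set.ncard_eq_zero (Set.toFinite _), Set.eq_empty_iff_forall_notMem]
          intro y hy
          have h1 := t.dep_par _ _ hy
          have h2 := hmax y (by
            simp only [Finset.mem_filter, Finset.mem_univ, true_and] at hx ⊢
            exact Relation.ReflTransGen.tail hx hy)
          omega
        rw [← h0]
        exact Finset.single_le_sum (f := fun x => ({t.cc x} : Multiset ℕ))
          (fun i _ => Multiset.zero_le _) hx
      · have : {u : V | u ∈ U ∧ Ancestor G r w u} = ∅ := by
          rw [Set.eq_empty_iff_forall_notMem]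
          rintro x ⟨h1, h2⟩
          exact hrel ⟨x, h1, h2⟩
        rw [this]; simp
  choose m u hseq hleaves hheight using hA
  have hcard : Fintype.card {w // IsChild G r v w} = t.cc v := by
    rw [← hout, ← Nat.card_eq_fintype_card]
    rfl
  have hwdep : ∀ w : {w // IsChild G r v w}, t.dep w.1 = t.dep v + 1 := fun w =>
    t.dep_par _ _ ((hch _ _).mp w.2)
  have hfeas : ∃ h ∈ hFeas (outDegSeq G r) k, h ≤ sSup S + 1 := by
    refine (RTree.join u).feas _ _ _ ?_ ?_ ?_
    · rw [RTree.join_seq, hcard]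
      refine le_trans (add_le_add le_rfl (Finset.sum_le_sum fun w _ => hseq w)) ?_
      simp only [hsubSeq]
      rw [← Finset.sum_biUnion]
      · rw [← Finset.sum_insert (f := fun x => ({t.cc x} : Multiset ℕ)), hfull]
        · exact Finset.sum_le_sum_of_subset (Finset.subset_univ _)
        · simp only [Finset.mem_biUnion, Finset.mem_univ, Finset.mem_filter, true_and, not_exists]
          intro w hw
          have h1 := hw.dep_le
          have h2 := hwdep w
          omega
      · intro a _ b _ hab
        simp only [Function.onFun]
        rw [Finset.disjoint_left]
        intro x hx hx'
        simp only [Finset.mem_univ, Finset.mem_filter, true_and] at hx hx'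
        exact hab (Subtype.ext (hx.unique hx' (by rw [hwdep, hwdep])))
    · refine le_trans ?_ (RTree.join_leaves u)
      refine le_trans ?_ (Finset.sum_le_sum fun w _ => hleaves w)
      have hvU : v ∉ U := by
        intro hv
        obtain ⟨x, hx, hxv⟩ := Finset.exists_mem_ne (by omega : 1 < U.card) v
        have := hanc x hx
        rw [hanc_iff] at this
        rcases Relation.ReflTransGen.cases_head this with h | ⟨c, hc, -⟩
        · exact hxv h.symm
        · exact hU v hv c ((hch _ _).mpr hc)
      have hcov : U ⊆ Finset.univ.biUnion (fun w : {w // IsChild G r v w} =>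
          U.filter (fun x => Ancestor G r w.1 x)) := by
        intro x hx
        have := hanc x hx
        rw [hanc_iff] at this
        rcases Relation.ReflTransGen.cases_head this with h | ⟨c, hc, hcx⟩
        · subst h; exact absurd hx hvU
        · simp only [Finset.mem_biUnion, Finset.mem_univ, Finset.mem_filter, true_and]
          exact ⟨⟨c, (hch _ _).mpr hc⟩, hx, (hanc_iff _ _).mpr hcx⟩
      rw [← hk]
      refine (Finset.card_le_card hcov).trans (Finset.card_biUnion_le.trans ?_)
      refine Finset.sum_le_sum fun w _ => le_of_eq ?_
      rw [← Set.ncard_coe_finset]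
      congr 1
      ext x
      simp
    · rintro (_ | ⟨i, a⟩)
      · exact Nat.zero_le _
      · exact Nat.succ_le_succ (hheight i a)
  obtain ⟨h, hh, hle⟩ := hfeas
  exact (Nat.sInf_le hh).trans hle
end

section
/- If s⁺ is the out-degree sequence of some rooted tree, s⁺ contains no entry equal to 1, and ℓ is the number of 0 entries of s⁺, then h(s⁺) = h(s⁺, ℓ), i.e., the minimum height over rooted trees with out-degree sequence exactly s⁺ equals the minimum height over rooted trees whose out-degree sequence is a subsequence of s⁺ and which have at least ℓ leaves. -/
open SimpleGraph

lemma sum_outdeg_aux {m : ℕ} (G : SimpleGraph (Fin m)) (r : Fin m) (hG : G.IsTree) :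
    (outDegSeq G r).sum + 1 = Multiset.card (outDegSeq G r) := by
  classical
  have hc := hG.card_edgeFinset
  have h2 : (outDegSeq G r).sum =
      ((Finset.univ : Finset (Fin m)).sigma
        (fun v => Finset.univ.filter (fun u => IsChild G r v u))).card := by
    rw [Finset.card_sigma]
    unfold outDegSeq outdeg
    change Finset.sum _ _ = _
    refine Finset.sum_congr rfl fun v _ => ?_
    rw [Set.ncard_eq_toFinset_card']
    congr 1
    ext u
    simp
  have h3 : ((Finset.univ : Finset (Fin m)).sigma
        (fun v => Finset.univ.filter (fun u => IsChild G r v u))).card = G.edgeFinset.card := by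
    refine Finset.card_bij (fun p _ => s(p.1, p.2)) ?_ ?_ ?_
    · rintro ⟨v, u⟩ h
      simp only [Finset.mem_sigma, Finset.mem_univ, Finset.mem_filter, true_and] at h
      simpa using h.1
    · rintro ⟨v, u⟩ h ⟨v', u'⟩ h' e
      simp only [Finset.mem_sigma, Finset.mem_univ, Finset.mem_filter, true_and] at h h'
      rcases Sym2.eq_iff.1 e with ⟨a, b⟩ | ⟨a, b⟩
      · simp only at a b
        subst a; subst b; rfl
      · simp only at a b
        subst a; subst b
        have := h.2
        have := h'.2
        omega
    · intro e he
      induction e using Sym2.ind with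
      | _ v u =>
        have ha : G.Adj v u := by simpa using he
        have hne := hG.dist_ne_of_adj r ha
        have t1 := hG.connected.dist_triangle (u := r) (v := v) (w := u)
        have t2 := hG.connected.dist_triangle (u := r) (v := u) (w := v)
        have d1 : G.dist v u = 1 := SimpleGraph.dist_eq_one_iff_adj.2 ha
        have d2 : G.dist u v = 1 := SimpleGraph.dist_eq_one_iff_adj.2 ha.symm
        rcases lt_or_gt_of_ne hne with h | h
        · refine ⟨⟨v, u⟩, ?_, rfl⟩
          simp only [Finset.mem_sigma, Finset.mem_univ, Finset.mem_filter, true_and]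
          exact ⟨ha, by omega⟩
        · refine ⟨⟨u, v⟩, ?_, Sym2.eq_swap⟩
          simp only [Finset.mem_sigma, Finset.mem_univ, Finset.mem_filter, true_and]
          exact ⟨ha.symm, by omega⟩
  have h4 : Multiset.card (outDegSeq G r) = m := by simp [outDegSeq]
  rw [h2, h3, hc, h4]
  simp

lemma leaves_eq_aux {m : ℕ} (G : SimpleGraph (Fin m)) (r : Fin m) :
    {v | IsRLeaf G r v}.ncard = (outDegSeq G r).count 0 := by
  classical
  unfold outDegSeq
  rw [Multiset.count_map, Set.ncard_eq_toFinset_card']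
  change _ = (Finset.univ.filter (fun a => 0 = outdeg G r a)).card
  congr 1
  ext v
  simp only [Set.mem_toFinset, Set.mem_setOf_eq, Finset.mem_filter, Finset.mem_univ, true_and]
  unfold outdeg
  rw [eq_comm, Set.ncard_eq_zero (Set.toFinite _), Set.eq_empty_iff_forall_notMem]
  rfl

lemma two_mul_card_le_aux (t : Multiset ℕ) (h : ∀ x ∈ t, 2 ≤ x) :
    2 * Multiset.card t ≤ t.sum := by
  have := Multiset.card_nsmul_le_sum h
  simpa [mul_comm] using this

/-- If `s⁺` is the out-degree sequence of some rooted tree, contains no entry equal to `1`,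
and has `ℓ` zero entries, then `h(s⁺) = h(s⁺, ℓ)`. -/
theorem stmt_12 (s : Multiset ℕ)
    (hs : ∃ (G : SimpleGraph (Fin (Multiset.card s))) (r : Fin (Multiset.card s)),
      G.IsTree ∧ outDegSeq G r = s)
    (h1 : 1 ∉ s) (ℓ : ℕ) (hℓ : ℓ = s.count 0) :
    hSeq s = hSeqK s ℓ := by
  subst hℓ
  obtain ⟨G₀, r₀, hG₀, hs₀⟩ := hs
  have hsum : s.sum + 1 = Multiset.card s := by
    have := sum_outdeg_aux G₀ r₀ hG₀
    rwa [hs₀] at this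
  unfold hSeq hSeqK hFeas
  congr 1
  ext h
  constructor
  · rintro ⟨G, r, hG, hseq, hh⟩
    refine ⟨_, G, r, hG, hseq.le, ?_, hh⟩
    rw [leaves_eq_aux, hseq]
  · rintro ⟨m, G, r, hG, hle, hk, hh⟩
    rw [leaves_eq_aux] at hk
    have hS := sum_outdeg_aux G r hG
    obtain ⟨t, ht⟩ := Multiset.le_iff_exists_add.1 hle
    have hcard := congrArg Multiset.card ht
    have hsm := congrArg Multiset.sum ht
    have hc0 := congrArg (Multiset.count 0) ht
    rw [Multiset.card_add] at hcard
    rw [Multiset.sum_add] at hsm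
    rw [Multiset.count_add] at hc0
    have ht0 : 0 ∉ t := Multiset.count_eq_zero.1 (by omega)
    have ht1 : 1 ∉ t := fun hx => h1 (by rw [ht]; exact Multiset.mem_add.2 (Or.inr hx))
    have h2t := two_mul_card_le_aux t (fun x hx => by
      have a0 : x ≠ 0 := fun e => ht0 (e ▸ hx)
      have a1 : x ≠ 1 := fun e => ht1 (e ▸ hx)
      omega)
    have htz : t = 0 := Multiset.card_eq_zero.1 (by omega)
    have heq : outDegSeq G r = s := by rw [ht, htz, add_zero]
    have hm : m = Multiset.card s := by rw [← heq]; simp [outDegSeq]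
    subst hm
    exact ⟨G, r, hG, heq, hh⟩
end
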